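/- arXiv:2202.00420 — 3 statements merged into one kernel-verified Lean document; each statement's English description precedes it below -/
import Mathlib

section
/- Suppose Assumption CS holds. Then x* is the unique minimizer of the ℓ¹ norm over {x ∈ X : Ax = b*}, and, setting Q_s := 1/√(1 − θ_s) and M_s := θ_{s,s}/(1 − θ_s − θ_{s,2s}), for the primal–dual algorithm run with R = ℓ¹ norm, F = 0, noisy data b^δ with ‖b^δ − b*‖ ≤ δ ≤ 1 and errors 0 ≤ ε_k ≤ C₀δ, under the stepsize conditions (1 − τ_M σ_M‖A‖² ≥ 0 and existence of ξ ∈ (0,1), η > 1 with ξ − τ_M σ_M‖A‖² ≥ 0 and σ_m(η−1) − σ_Mξη > 0) and initialization y₀ = y₋₁ + Σ(Ax₀ − b^δ), there exist constants c₁,…,c₉ ≥ 0, independent of k and of δ, such that for every k ≥ 1: ‖x̂_k − x*‖ ≤ Q_s·√(c₁/k + c₂δ + c₃δ^{3/2}√k + c₄δ²k + c₅δ²) + ((1 + Q_s‖A‖)/(1 − M_s))·(c₆/k + c₇δ + c₈δ^{3/2}√k + c₉δ²k). -/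
open scoped RealInnerProductSpace ENNReal NNReal
open Filter Topology

noncomputable section

/-- The `ε`-subdifferential of an extended-real-valued function `R` at `x`:
`∂_ε R (x) = {u : ∀ x', R x - R x' ≤ ⟪u, x - x'⟫ + ε}`, written without `EReal` subtraction. -/
def epsSubdiff {X : Type*} [NormedAddCommGroup X] [InnerProductSpace ℝ X]
    (R : X → EReal) (ε : ℝ) (x : X) : Set X :=
  {u | ∀ x' : X, R x + ((⟪u, x' - x⟫ - ε : ℝ) : EReal) ≤ R x'}

/-- Convexity for extended-real-valued functions. -/
def ERealConvex {X : Type*} [AddCommGroup X] [Module ℝ X] (R : X → EReal) : Prop :=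
  ∀ x y : X, ∀ t : ℝ, 0 ≤ t → t ≤ 1 →
    R (t • x + (1 - t) • y) ≤ (t : EReal) * R x + ((1 - t : ℝ) : EReal) * R y

/-- `R` is proper, convex and lower semicontinuous. -/
def ProperConvexLsc {X : Type*} [NormedAddCommGroup X] [InnerProductSpace ℝ X]
    (R : X → EReal) : Prop :=
  (∃ x, R x ≠ ⊤) ∧ (∀ x, R x ≠ ⊥) ∧ ERealConvex R ∧ LowerSemicontinuous R

/-- The Lagrangian `L_b(x,y) = R x + F x + ⟪y, A x - b⟫`. -/
def Lag {X Y : Type*} [NormedAddCommGroup X] [InnerProductSpace ℝ X]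
    [NormedAddCommGroup Y] [InnerProductSpace ℝ Y]
    (R : X → EReal) (F : X → ℝ) (A : X →L[ℝ] Y) (b : Y) (x : X) (y : Y) : EReal :=
  R x + ((F x + ⟪y, A x - b⟫ : ℝ) : EReal)

/-- Saddle points of the Lagrangian `L_b`. -/
def IsSaddle {X Y : Type*} [NormedAddCommGroup X] [InnerProductSpace ℝ X]
    [NormedAddCommGroup Y] [InnerProductSpace ℝ Y]
    (R : X → EReal) (F : X → ℝ) (A : X →L[ℝ] Y) (b : Y) (p : X × Y) : Prop :=
  ∀ x : X, ∀ y : Y, Lag R F A b p.1 y ≤ Lag R F A b x p.2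

/-- Weak convergence of a sequence in a Hilbert space. -/
def WeakTendsto {X : Type*} [NormedAddCommGroup X] [InnerProductSpace ℝ X]
    (u : ℕ → X) (l : X) : Prop :=
  ∀ w : X, Tendsto (fun k => ⟪u k, w⟫) atTop (nhds ⟪l, w⟫)

/-- `V(x,y) = ½‖x‖_T² + ½‖y‖_Σ²`, written via the inverses of the preconditioners. -/
def Vfun {X Y : Type*} [NormedAddCommGroup X] [InnerProductSpace ℝ X]
    [NormedAddCommGroup Y] [InnerProductSpace ℝ Y]
    (Tinv : X →L[ℝ] X) (Sginv : Y →L[ℝ] Y) (z : X × Y) : ℝ :=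
  1 / 2 * ⟪Tinv z.1, z.1⟫ + 1 / 2 * ⟪Sginv z.2, z.2⟫

variable {X Y : Type*}
  [NormedAddCommGroup X] [InnerProductSpace ℝ X] [CompleteSpace X]
  [NormedAddCommGroup Y] [InnerProductSpace ℝ Y] [CompleteSpace Y]

/-- The `ℓ¹`-norm on `ℓ² = lp (fun _ : ℕ => ℝ) 2`, as an extended real number. -/
def l1norm (x : lp (fun _ : ℕ => ℝ) 2) : EReal :=
  ((∑' i : ℕ, (‖x i‖₊ : ℝ≥0∞) : ℝ≥0∞) : EReal)

/-- `x` has support of cardinality at most `s`. -/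
def SuppLe (x : lp (fun _ : ℕ => ℝ) 2) (s : ℕ) : Prop :=
  {i : ℕ | x i ≠ 0}.Finite ∧ {i : ℕ | x i ≠ 0}.ncard ≤ s

/-! ### Truncations of `ℓ²` sequences -/

/-- The restriction of an `ℓ²` sequence to a finite set of indices. -/
def truncate (F : Finset ℕ) (h : lp (fun _ : ℕ => ℝ) 2) : lp (fun _ : ℕ => ℝ) 2 :=
  ∑ i ∈ F, lp.single 2 i (h i)

theorem truncate_apply (F : Finset ℕ) (h : lp (fun _ : ℕ => ℝ) 2) (j : ℕ) :
    truncate F h j = if j ∈ F then h j else 0 := by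
  rw [truncate, lp.coeFn_sum, Finset.sum_apply]
  simp [Pi.single_apply]

theorem norm_truncate_sq (F : Finset ℕ) (h : lp (fun _ : ℕ => ℝ) 2) :
    ‖truncate F h‖ ^ 2 = ∑ i ∈ F, |h i| ^ 2 := by
  have := lp.norm_sum_single (p := 2) (E := fun _ : ℕ => ℝ) (by norm_num) (fun i => h i) F
  simpa [truncate] using this

theorem norm_truncate_le_sum (F : Finset ℕ) (h : lp (fun _ : ℕ => ℝ) 2) :
    ‖truncate F h‖ ≤ ∑ i ∈ F, |h i| := by
  refine (norm_sum_le _ _).trans (le_of_eq (Finset.sum_congr rfl fun i _ => ?_))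
  rw [lp.norm_single (by norm_num)]
  rfl

theorem truncate_sub (F : Finset ℕ) (x y : lp (fun _ : ℕ => ℝ) 2) :
    truncate F (x - y) = truncate F x - truncate F y := by
  simp [truncate, lp.single_sub, Finset.sum_sub_distrib]

theorem truncate_add_truncate_sdiff {S F : Finset ℕ} (hSF : S ⊆ F)
    (h : lp (fun _ : ℕ => ℝ) 2) : truncate S h + truncate (F \ S) h = truncate F h := by
  rw [add_comm]
  exact Finset.sum_sdiff hSF

theorem tendsto_truncate (h : lp (fun _ : ℕ => ℝ) 2) :
    Tendsto (fun F => truncate F h) atTop (𝓝 h) :=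
  lp.hasSum_single (by norm_num) h

theorem support_truncate_subset (F : Finset ℕ) (h : lp (fun _ : ℕ => ℝ) 2) :
    {i : ℕ | truncate F h i ≠ 0} ⊆ F := by
  intro i hi
  by_contra hF
  exact hi (by rw [truncate_apply, if_neg (by simpa using hF)])

theorem suppLe_truncate {F : Finset ℕ} {s : ℕ} (hF : F.card ≤ s) (h : lp (fun _ : ℕ => ℝ) 2) :
    SuppLe (truncate F h) s :=
  ⟨F.finite_toSet.subset (support_truncate_subset F h),
    (Set.ncard_le_ncard (support_truncate_subset F h) F.finite_toSet).trans
      (by rwa [Set.ncard_coe_finset])⟩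

theorem disjoint_support_truncate {F G : Finset ℕ} (hFG : Disjoint F G)
    (h : lp (fun _ : ℕ => ℝ) 2) :
    Disjoint {i : ℕ | truncate F h i ≠ 0} {i : ℕ | truncate G h i ≠ 0} :=
  (Finset.disjoint_coe.2 hFG).mono (support_truncate_subset F h) (support_truncate_subset G h)

theorem norm_truncate_le_sqrt_mul {F : Finset ℕ} {s : ℕ} (hF : F.card ≤ s)
    (h : lp (fun _ : ℕ => ℝ) 2) {t : ℝ} (ht : 0 ≤ t) (hb : ∀ i ∈ F, |h i| ≤ t) :
    ‖truncate F h‖ ≤ √s * t := by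
  have hsq : ‖truncate F h‖ ^ 2 ≤ (√s * t) ^ 2 := by
    rw [norm_truncate_sq, mul_pow, Real.sq_sqrt (Nat.cast_nonneg s)]
    calc ∑ i ∈ F, |h i| ^ 2 ≤ ∑ _i ∈ F, t ^ 2 :=
          Finset.sum_le_sum fun i hi => pow_le_pow_left₀ (abs_nonneg _) (hb i hi) 2
      _ = (F.card : ℝ) * t ^ 2 := by simp
      _ ≤ s * t ^ 2 := by gcongr
  exact le_of_sq_le_sq hsq (by positivity)

theorem sum_le_sqrt_mul_norm_truncate {F : Finset ℕ} {s : ℕ} (hF : F.card ≤ s)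
    (h : lp (fun _ : ℕ => ℝ) 2) : ∑ i ∈ F, |h i| ≤ √s * ‖truncate F h‖ := by
  have hsq : (∑ i ∈ F, |h i|) ^ 2 ≤ (√s * ‖truncate F h‖) ^ 2 := by
    rw [mul_pow, Real.sq_sqrt (Nat.cast_nonneg s), norm_truncate_sq]
    refine sq_sum_le_card_mul_sum_sq.trans ?_
    gcongr
  exact le_of_sq_le_sq hsq (by positivity)

/-- Selection of the (at most) `s` largest entries of `h` on `F`, with a threshold `t`. -/
theorem exists_largest_entries (h : ℕ → ℝ) (F : Finset ℕ) (s : ℕ) :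
    ∃ S ⊆ F, ∃ t : ℝ, 0 ≤ t ∧ S.card ≤ s ∧ (∀ i ∈ S, t ≤ |h i|) ∧ (∀ i ∈ F \ S, |h i| ≤ t) ∧
      ((F ⊆ S ∧ t = 0) ∨ S.card = s) := by
  induction s with
  | zero =>
    refine ⟨∅, by simp, ∑ i ∈ F, |h i|, Finset.sum_nonneg fun _ _ => abs_nonneg _, by simp,
      by simp, fun i hi => ?_, Or.inr rfl⟩
    exact Finset.single_le_sum (f := fun i => |h i|) (fun _ _ => abs_nonneg _) (by simpa using hi)
  | succ s ih =>
    obtain ⟨S, hSF, t, ht, hcard, hlow, hup, hS⟩ := ih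
    by_cases hFS : F ⊆ S
    · exact ⟨S, hSF, 0, le_rfl, hcard.trans (Nat.le_succ s), fun _ _ => abs_nonneg _,
        fun i hi => absurd (hFS (Finset.mem_sdiff.1 hi).1) (Finset.mem_sdiff.1 hi).2,
        Or.inl ⟨hFS, rfl⟩⟩
    · have hcard' : S.card = s := hS.resolve_left fun hh => hFS hh.1
      obtain ⟨m, hm, hmax⟩ := Finset.exists_max_image (F \ S) (fun i => |h i|)
        (Finset.sdiff_nonempty.2 hFS)
      have hm' := Finset.mem_sdiff.1 hm
      have hins : (insert m S).card = s + 1 := by rw [Finset.card_insert_of_notMem hm'.2, hcard']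
      refine ⟨insert m S, Finset.insert_subset hm'.1 hSF, |h m|, abs_nonneg _, hins.le,
        fun i hi => ?_, fun i hi => hmax i ?_, Or.inr hins⟩
      · rcases Finset.mem_insert.1 hi with rfl | hi
        · exact le_rfl
        · exact (hup m hm).trans (hlow i hi)
      · rw [Finset.mem_sdiff, Finset.mem_insert] at hi
        exact Finset.mem_sdiff.2 ⟨hi.1, fun h' => hi.2 (Or.inr h')⟩

/-! ### Robust null space property and exact penalization -/

section Recovery

variable {Y : Type*} [NormedAddCommGroup Y] [InnerProductSpace ℝ Y]
  {A : lp (fun _ : ℕ => ℝ) 2 →L[ℝ] Y} {s : ℕ} {θ : ℝ}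

theorem abs_inner_truncate_le (hs : 0 < s) (hθ : 0 ≤ θ)
    (horth : ∀ x x' : lp (fun _ : ℕ => ℝ) 2, SuppLe x s → SuppLe x' s →
      Disjoint {i : ℕ | x i ≠ 0} {i : ℕ | x' i ≠ 0} → |⟪A x, A x'⟫| ≤ θ * ‖x‖ * ‖x'‖)
    (h : lp (fun _ : ℕ => ℝ) 2) {S : Finset ℕ} (hS : S.card ≤ s) (G : Finset ℕ) :
    ∀ t : ℝ, 0 ≤ t → Disjoint S G → (∀ i ∈ G, |h i| ≤ t) →
      |⟪A (truncate S h), A (truncate G h)⟫|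
        ≤ θ * ‖truncate S h‖ * (√s * t + (∑ i ∈ G, |h i|) / √s) := by
  have hsr : 0 < √(s : ℝ) := Real.sqrt_pos.2 (Nat.cast_pos.2 hs)
  induction G using Finset.strongInduction with
  | H G ih =>
    intro t ht hSG hup
    rcases G.eq_empty_or_nonempty with rfl | hG
    · simp only [truncate, Finset.sum_empty, map_zero, inner_zero_right, abs_zero]
      positivity
    obtain ⟨S₁, hS₁G, t₁, ht₁, hcard, hlow, hup₁, hS₁⟩ := exists_largest_entries h G s
    have hne : S₁.Nonempty := by
      rcases hS₁ with hh | hh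
      · exact hG.mono hh.1
      · exact Finset.card_pos.1 (hh ▸ hs)
    have hst : (s : ℝ) * t₁ ≤ ∑ i ∈ S₁, |h i| := by
      rcases hS₁ with ⟨-, rfl⟩ | hh
      · simpa using Finset.sum_nonneg fun i (_ : i ∈ S₁) => abs_nonneg (h i)
      · rw [← hh, ← nsmul_eq_mul]
        exact Finset.card_nsmul_le_sum _ _ _ hlow
    have hrest := ih (G \ S₁) (Finset.sdiff_ssubset hS₁G hne) t₁ ht₁
      (hSG.mono_right Finset.sdiff_subset) hup₁
    have hfirst : |⟪A (truncate S h), A (truncate S₁ h)⟫| ≤ θ * ‖truncate S h‖ * (√s * t) :=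
      (horth _ _ (suppLe_truncate hS h) (suppLe_truncate hcard h)
        (disjoint_support_truncate (hSG.mono_right hS₁G) h)).trans
        (mul_le_mul_of_nonneg_left
          (norm_truncate_le_sqrt_mul hcard h ht fun i hi => hup i (hS₁G hi)) (by positivity))
    have hsplit : √s * t₁ + (∑ i ∈ G \ S₁, |h i|) / √s ≤ (∑ i ∈ G, |h i|) / √s := by
      rw [← Finset.sum_sdiff hS₁G (f := fun i => |h i|), le_div_iff₀ hsr, add_mul,
        div_mul_cancel₀ _ hsr.ne']
      have : √(s : ℝ) * t₁ * √s = s * t₁ := by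
        rw [mul_right_comm, Real.mul_self_sqrt (Nat.cast_nonneg s)]
      linarith
    rw [← truncate_add_truncate_sdiff hS₁G h, map_add, inner_add_right]
    calc _ ≤ _ := abs_add_le _ _
      _ ≤ θ * ‖truncate S h‖ * (√s * t)
          + θ * ‖truncate S h‖ * (√s * t₁ + (∑ i ∈ G \ S₁, |h i|) / √s) :=
        add_le_add hfirst hrest
      _ ≤ θ * ‖truncate S h‖ * (√s * t)
          + θ * ‖truncate S h‖ * ((∑ i ∈ G, |h i|) / √s) := by gcongr
      _ = _ := by ring

/-- A set of `s` largest entries dominates every other set of at most `s` entries. -/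
theorem sum_le_sum_largest_entries {h : ℕ → ℝ} {F S S₀ : Finset ℕ} {t : ℝ} (ht : 0 ≤ t)
    (hS : S.card ≤ s) (hSF : S ⊆ F) (hlow : ∀ i ∈ S₀, t ≤ |h i|)
    (hup : ∀ i ∈ F \ S₀, |h i| ≤ t) (hS₀ : (F ⊆ S₀ ∧ t = 0) ∨ S₀.card = s) :
    ∑ i ∈ S, |h i| ≤ ∑ i ∈ S₀, |h i| := by
  rcases hS₀ with ⟨hF, -⟩ | hcard
  · exact Finset.sum_le_sum_of_subset_of_nonneg (hSF.trans hF) fun _ _ _ => abs_nonneg _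
  · rw [← Finset.sum_inter_add_sum_sdiff S S₀, ← Finset.sum_inter_add_sum_sdiff S₀ S,
      Finset.inter_comm]
    have hle : (S \ S₀).card ≤ (S₀ \ S).card := by
      have h₁ := Finset.card_sdiff_add_card_inter S S₀
      have h₂ := Finset.card_sdiff_add_card_inter S₀ S
      rw [Finset.inter_comm] at h₂
      omega
    have h₁ : ∑ i ∈ S \ S₀, |h i| ≤ (S \ S₀).card • t :=
      Finset.sum_le_card_nsmul _ _ _ fun i hi => hup i
        (Finset.sdiff_subset_sdiff hSF subset_rfl hi)
    have h₂ : (S₀ \ S).card • t ≤ ∑ i ∈ S₀ \ S, |h i| :=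
      Finset.card_nsmul_le_sum _ _ _ fun i hi => hlow i (Finset.mem_sdiff.1 hi).1
    have h₃ : (S \ S₀).card • t ≤ (S₀ \ S).card • t := by
      simp only [nsmul_eq_mul]
      gcongr
    linarith

/-- Robust null space property for finitely supported vectors. -/
theorem null_space_property {θs : ℝ} (hθ : 0 ≤ θ) (hsum : θs + 2 * θ < 1)
    (hRIP : ∀ x : lp (fun _ : ℕ => ℝ) 2, SuppLe x s → (1 - θs) * ‖x‖ ^ 2 ≤ ‖A x‖ ^ 2)
    (horth : ∀ x x' : lp (fun _ : ℕ => ℝ) 2, SuppLe x s → SuppLe x' s →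
      Disjoint {i : ℕ | x i ≠ 0} {i : ℕ | x' i ≠ 0} → |⟪A x, A x'⟫| ≤ θ * ‖x‖ * ‖x'‖)
    (h : lp (fun _ : ℕ => ℝ) 2) {S F : Finset ℕ} (hS : S.card ≤ s) (hSF : S ⊆ F) :
    (1 - θs - θ) * ∑ i ∈ S, |h i|
      ≤ θ * ∑ i ∈ F \ S, |h i| + √s * ‖A‖ * ‖A (truncate F h)‖ := by
  rcases s.eq_zero_or_pos with rfl | hs
  · obtain rfl : S = ∅ := Finset.card_eq_zero.1 (Nat.le_zero.1 hS)
    have : 0 ≤ ∑ i ∈ F, |h i| := Finset.sum_nonneg fun _ _ => abs_nonneg _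
    rw [Finset.sum_empty, Finset.sdiff_empty, mul_zero]
    positivity
  obtain ⟨S₀, hS₀F, t, ht, hcard, hlow, hup, hS₀⟩ := exists_largest_entries h F s
  have hsr : 0 < √(s : ℝ) := Real.sqrt_pos.2 (Nat.cast_pos.2 hs)
  have hdom := sum_le_sum_largest_entries ht hS hSF hlow hup hS₀
  have hst : (s : ℝ) * t ≤ ∑ i ∈ S₀, |h i| := by
    rcases hS₀ with ⟨-, rfl⟩ | hh
    · simpa using Finset.sum_nonneg fun i (_ : i ∈ S₀) => abs_nonneg (h i)
    · rw [← hh, ← nsmul_eq_mul]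
      exact Finset.card_nsmul_le_sum _ _ _ hlow
  have hinner := abs_inner_truncate_le hs hθ horth h hcard (F \ S₀) t ht
    Finset.disjoint_sdiff hup
  have hrip := hRIP _ (suppLe_truncate hcard h)
  have htot₀ := Finset.sum_sdiff hS₀F (f := fun i => |h i|)
  have htot := Finset.sum_sdiff hSF (f := fun i => |h i|)
  have hroot := sum_le_sqrt_mul_norm_truncate hcard h
  set u := truncate S₀ h
  set w := truncate F h
  set v := truncate (F \ S₀) h
  set a := ∑ i ∈ S₀, |h i|
  set b := ∑ i ∈ F \ S₀, |h i|
  have huv : u + v = w := truncate_add_truncate_sdiff hS₀F h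
  have hexp : ‖A u‖ ^ 2 = ⟪A u, A w⟫ - ⟪A u, A v⟫ := by
    rw [← huv, map_add, inner_add_right, real_inner_self_eq_norm_sq]
    ring
  have hAw : ⟪A u, A w⟫ ≤ ‖A‖ * ‖u‖ * ‖A w‖ :=
    (real_inner_le_norm _ _).trans (by gcongr; exact A.le_opNorm u)
  have hnorm : (1 - θs) * ‖u‖ ≤ ‖A‖ * ‖A w‖ + θ * (√s * t + b / √s) := by
    rcases (norm_nonneg u).eq_or_lt with h0 | h0
    · have hb : 0 ≤ b := Finset.sum_nonneg fun _ _ => abs_nonneg _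
      rw [← h0, mul_zero]
      positivity
    · refine le_of_mul_le_mul_right ?_ h0
      nlinarith [neg_abs_le ⟪A u, A v⟫]
  have hmain : (1 - θs) * a ≤ √s * ‖A‖ * ‖A w‖ + θ * (a + b) := by
    have h₁ : (1 - θs) * a ≤ √s * ((1 - θs) * ‖u‖) := by nlinarith
    have h₂ := mul_le_mul_of_nonneg_left hnorm hsr.le
    have h₃ : √(s : ℝ) * (θ * (√s * t + b / √s)) = θ * (s * t + b) := by
      have : √(s : ℝ) * √s = s := Real.mul_self_sqrt (Nat.cast_nonneg s)
      field_simp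
      rw [Real.sq_sqrt (Nat.cast_nonneg s), mul_comm t]
    have h₄ : θ * (s * t + b) ≤ θ * (a + b) := by gcongr
    nlinarith
  nlinarith

/-- Exact penalization: the `ℓ¹` norm plus a multiple of the residual grows linearly
away from the sparse solution. -/
theorem exists_exact_penalty {θs : ℝ} (hθ : 0 ≤ θ) (hsum : θs + 2 * θ < 1)
    (hRIP : ∀ x : lp (fun _ : ℕ => ℝ) 2, SuppLe x s → (1 - θs) * ‖x‖ ^ 2 ≤ ‖A x‖ ^ 2)
    (horth : ∀ x x' : lp (fun _ : ℕ => ℝ) 2, SuppLe x s → SuppLe x' s →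
      Disjoint {i : ℕ | x i ≠ 0} {i : ℕ | x' i ≠ 0} → |⟪A x, A x'⟫| ≤ θ * ‖x‖ * ‖x'‖)
    {xstar : lp (fun _ : ℕ => ℝ) 2} (hsupp : SuppLe xstar s) :
    ∃ κ C : ℝ, 0 < κ ∧ 0 ≤ C ∧ ∀ x : lp (fun _ : ℕ => ℝ) 2, Summable (fun i => |x i|) →
      κ * ‖x - xstar‖ ≤ ∑' i, |x i| - ∑' i, |xstar i| + C * ‖A x - A xstar‖ := by
  set τ := √s * ‖A‖
  have hτ0 : 0 ≤ τ := by positivity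
  set c := 1 - θs - θ with hc
  have hc0 : 0 < c := by linarith
  refine ⟨(c - θ) / (c + θ), 2 * τ / (c + θ), div_pos (by linarith) (by linarith),
    div_nonneg (by linarith) (by linarith), fun x hx => ?_⟩
  set S := hsupp.1.toFinset with hS
  have hScard : S.card ≤ s := by
    rw [hS, ← Set.ncard_eq_toFinset_card _ hsupp.1]
    exact hsupp.2
  have hoff : ∀ i ∉ S, xstar i = 0 := fun i hi => by
    by_contra hne
    exact hi (hsupp.1.mem_toFinset.2 hne)
  have hstar : Summable (fun i => |xstar i|) :=
    summable_of_ne_finset_zero (s := S) fun i hi => by rw [hoff i hi, abs_zero]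
  have hlim : Tendsto (fun F => (c - θ) / (c + θ) * ‖truncate F (x - xstar)‖) atTop
      (𝓝 ((c - θ) / (c + θ) * ‖x - xstar‖)) := (tendsto_truncate _).norm.const_mul _
  have hlim' : Tendsto (fun F => ∑ i ∈ F, |x i| - ∑ i ∈ F, |xstar i|
      + 2 * τ / (c + θ) * ‖A (truncate F (x - xstar))‖) atTop
      (𝓝 (∑' i, |x i| - ∑' i, |xstar i| + 2 * τ / (c + θ) * ‖A x - A xstar‖)) := by
    rw [← map_sub]
    exact (hx.hasSum.sub hstar.hasSum).congr (fun F => by rw [Finset.sum_sub_distrib]) |>.add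
      (((A.continuous.tendsto _).comp (tendsto_truncate _)).norm.const_mul _)
  refine le_of_tendsto_of_tendsto hlim hlim' ?_
  filter_upwards [eventually_ge_atTop S] with F hSF
  set h := x - xstar with hh
  have hns := null_space_property hθ hsum hRIP horth h hScard hSF
  have hcoord : ∀ i, h i = x i - xstar i := fun i => rfl
  have hnorm := norm_truncate_le_sum F h
  rw [← Finset.sum_sdiff hSF] at hnorm
  have hin : ∑ i ∈ S, |xstar i| - ∑ i ∈ S, |h i| ≤ ∑ i ∈ S, |x i| := by
    rw [← Finset.sum_sub_distrib]
    refine Finset.sum_le_sum fun i _ => ?_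
    have := abs_sub_abs_le_abs_sub (xstar i) (x i)
    rw [hcoord, abs_sub_comm (x i)]
    linarith
  have hout : ∑ i ∈ F \ S, |x i| = ∑ i ∈ F \ S, |h i| :=
    Finset.sum_congr rfl fun i hi => by rw [hcoord, hoff i (Finset.mem_sdiff.1 hi).2, sub_zero]
  have hout' : ∑ i ∈ F \ S, |xstar i| = 0 :=
    Finset.sum_eq_zero fun i hi => by rw [hoff i (Finset.mem_sdiff.1 hi).2, abs_zero]
  rw [← Finset.sum_sdiff hSF (f := fun i => |x i|),
    ← Finset.sum_sdiff hSF (f := fun i => |xstar i|), hout, hout']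
  set p := ∑ i ∈ S, |h i|
  set q := ∑ i ∈ F \ S, |h i|
  have hcθ : 0 < c + θ := by linarith
  rw [div_mul_eq_mul_div, div_le_iff₀ hcθ, add_mul, div_mul_eq_mul_div, div_mul_cancel₀ _ hcθ.ne']
  have hd : 0 ≤ c - θ := by linarith
  nlinarith [mul_le_mul_of_nonneg_left hnorm hd, mul_le_mul_of_nonneg_left hin hcθ.le]

end Recovery

/-! ### Energy estimate for the primal–dual algorithm -/

section PrimalDual

variable {X Y : Type*} [NormedAddCommGroup X] [InnerProductSpace ℝ X]
  [NormedAddCommGroup Y] [InnerProductSpace ℝ Y]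

theorem norm_sq_le_mul_inner_inverse {S Sinv : X →L[ℝ] X} (hinv : ∀ v, S (Sinv v) = v)
    (hsa : ∀ u v, ⟪S u, v⟫ = ⟪u, S v⟫) {M : ℝ} (hM : 0 < M)
    (hb : ∀ u, 0 ≤ ⟪S u, u⟫ ∧ ⟪S u, u⟫ ≤ M * ‖u‖ ^ 2) (v : X) :
    ‖v‖ ^ 2 ≤ M * ⟪Sinv v, v⟫ := by
  have h := (hb (M • Sinv v - v)).1
  have hcross : ⟪S v, Sinv v⟫ = ‖v‖ ^ 2 := by
    rw [hsa, hinv, real_inner_self_eq_norm_sq]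
  simp only [map_sub, map_smul, hinv, inner_sub_left, inner_sub_right, real_inner_smul_left,
    real_inner_smul_right, hcross, real_inner_self_eq_norm_sq, real_inner_comm (Sinv v) v] at h
  refine le_of_mul_le_mul_left ?_ hM
  linarith [(hb v).2]

theorem inner_inverse_symm {S Sinv : X →L[ℝ] X} (hinv : ∀ v, S (Sinv v) = v)
    (hsa : ∀ u v, ⟪S u, v⟫ = ⟪u, S v⟫) (u v : X) : ⟪Sinv u, v⟫ = ⟪u, Sinv v⟫ := by
  conv_lhs => rw [← hinv v]
  rw [← hsa, hinv]

theorem abs_inner_le_half_add_half {A : X →L[ℝ] Y} {Tinv : X →L[ℝ] X} {Sginv : Y →L[ℝ] Y}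
    {τ σ : ℝ} (hτ : 0 < τ) (hσ : 0 < σ) (hA : τ * σ * ‖A‖ ^ 2 ≤ 1)
    (hT : ∀ d, ‖d‖ ^ 2 ≤ τ * ⟪Tinv d, d⟫) (hS : ∀ v, ‖v‖ ^ 2 ≤ σ * ⟪Sginv v, v⟫)
    (v : Y) (d : X) : |⟪v, A d⟫| ≤ 1 / 2 * ⟪Tinv d, d⟫ + 1 / 2 * ⟪Sginv v, v⟫ := by
  have hp : 0 ≤ ⟪Tinv d, d⟫ := nonneg_of_mul_nonneg_right ((sq_nonneg _).trans (hT d)) hτ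
  have hq : 0 ≤ ⟪Sginv v, v⟫ := nonneg_of_mul_nonneg_right ((sq_nonneg _).trans (hS v)) hσ
  have hle : |⟪v, A d⟫| ≤ ‖v‖ * (‖A‖ * ‖d‖) :=
    (abs_real_inner_le_norm _ _).trans (by gcongr; exact A.le_opNorm d)
  have hsq : (‖v‖ * (‖A‖ * ‖d‖)) ^ 2 ≤ ⟪Tinv d, d⟫ * ⟪Sginv v, v⟫ :=
    calc (‖v‖ * (‖A‖ * ‖d‖)) ^ 2 = ‖A‖ ^ 2 * (‖v‖ ^ 2 * ‖d‖ ^ 2) := by ring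
      _ ≤ ‖A‖ ^ 2 * ((σ * ⟪Sginv v, v⟫) * (τ * ⟪Tinv d, d⟫)) := by
        gcongr
        · exact hS v
        · exact hT d
      _ = τ * σ * ‖A‖ ^ 2 * (⟪Tinv d, d⟫ * ⟪Sginv v, v⟫) := by ring
      _ ≤ 1 * (⟪Tinv d, d⟫ * ⟪Sginv v, v⟫) := by gcongr
      _ = _ := one_mul _
  refine hle.trans (le_of_sq_le_sq ?_ (by positivity))
  nlinarith [sq_nonneg (⟪Tinv d, d⟫ - ⟪Sginv v, v⟫)]

/-- The energy decreasing along the primal–dual iteration: `d` is the primal error and `z`, `z'`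
are two consecutive dual iterates. -/
def primalDualEnergy (A : X →L[ℝ] Y) (Tinv : X →L[ℝ] X) (Sginv : Y →L[ℝ] Y)
    (y : Y) (d : X) (z z' : Y) : ℝ :=
  1 / 2 * ⟪Tinv d, d⟫ + 1 / 2 * ⟪Sginv (z' - y), z' - y⟫ - ⟪z' - z, A d⟫
    + 1 / 2 * ⟪Sginv (z' - z), z' - z⟫

theorem primalDualEnergy_step [CompleteSpace X] [CompleteSpace Y]
    {A : X →L[ℝ] Y} {Tinv : X →L[ℝ] X} {Sginv : Y →L[ℝ] Y}
    (hTsym : ∀ u v, ⟪Tinv u, v⟫ = ⟪u, Tinv v⟫) (hSsym : ∀ u v, ⟪Sginv u, v⟫ = ⟪u, Sginv v⟫)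
    (hcross : ∀ v d, |⟪v, A d⟫| ≤ 1 / 2 * ⟪Tinv d, d⟫ + 1 / 2 * ⟪Sginv v, v⟫)
    {x x' xstar : X} {z z' z'' y b : Y} {r ε : ℝ}
    (hz : Sginv (z'' - z') = A x' - b)
    (hr : r ≤ ⟪-(Tinv (x' - x)) - ContinuousLinearMap.adjoint A ((2 : ℝ) • z' - z),
      x' - xstar⟫ + ε) :
    r + ⟪y, A x' - b⟫ - ⟪z'', A xstar - b⟫
        + primalDualEnergy A Tinv Sginv y (x' - xstar) z' z''
      ≤ primalDualEnergy A Tinv Sginv y (x - xstar) z z' + ε := by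
  obtain ⟨d, rfl⟩ : ∃ d, x' = xstar + d := ⟨x' - xstar, by abel⟩
  obtain ⟨e, rfl⟩ : ∃ e, x = xstar + d - e := ⟨xstar + d - x, by abel⟩
  obtain ⟨g, rfl⟩ : ∃ g, z'' = z' + g := ⟨z'' - z', by abel⟩
  obtain ⟨p, rfl⟩ : ∃ p, y = z' + g - p := ⟨z' + g - y, by abel⟩
  obtain ⟨q, rfl⟩ : ∃ q, z = z' - q := ⟨z' - z, by abel⟩
  obtain ⟨n, rfl⟩ : ∃ n, b = A xstar - n := ⟨A xstar - b, by abel⟩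
  have e₁ : xstar + d - (xstar + d - e) = e := by abel
  have e₂ : xstar + d - xstar = d := by abel
  have e₃ : xstar + d - e - xstar = d - e := by abel
  have e₄ : z' + g - z' = g := by abel
  have e₅ : z' - (z' + g - p) = p - g := by abel
  have e₆ : z' + g - (z' + g - p) = p := by abel
  have e₇ : z' - (z' - q) = q := by abel
  have e₈ : (2 : ℝ) • z' - (z' - q) = z' + q := by rw [two_smul]; abel
  have e₉ : A (xstar + d) - (A xstar - n) = A d + n := by rw [map_add]; abel
  have e₁₀ : A xstar - (A xstar - n) = n := by abel
  rw [e₁, e₂, e₈] at hr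
  rw [e₄, e₉] at hz
  have hc := neg_le_of_abs_le (hcross q e)
  have hT : ⟪Tinv d, e⟫ = ⟪Tinv e, d⟫ := by rw [hTsym, real_inner_comm]
  have hS : ⟪Sginv p, g⟫ = ⟪A d + n, p⟫ := by rw [hSsym, hz, real_inner_comm]
  have hgn : ⟪A d + n, p⟫ = ⟪p, A d⟫ + ⟪p, n⟫ := by rw [real_inner_comm, inner_add_right]
  simp only [primalDualEnergy, e₂, e₃, e₄, e₅, e₆, e₇, e₉, e₁₀]
  simp only [inner_sub_left, inner_neg_left, ContinuousLinearMap.adjoint_inner_left,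
    inner_add_left] at hr
  simp only [map_sub, inner_sub_left, inner_sub_right, hT, hS, hz, hgn, inner_add_right,
    inner_add_left (𝕜 := ℝ) z' g]
  simp only [inner_add_left (𝕜 := ℝ) (A d) n, real_inner_comm p] at *
  linarith

theorem inner_le_primalDualEnergy {A : X →L[ℝ] Y} {Tinv : X →L[ℝ] X} {Sginv : Y →L[ℝ] Y}
    (hcross : ∀ v d, |⟪v, A d⟫| ≤ 1 / 2 * ⟪Tinv d, d⟫ + 1 / 2 * ⟪Sginv v, v⟫)
    (y : Y) (d : X) (z z' : Y) :
    1 / 2 * ⟪Sginv (z' - y), z' - y⟫ ≤ primalDualEnergy A Tinv Sginv y d z z' := by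
  have := le_of_abs_le (hcross (z' - z) d)
  rw [primalDualEnergy]
  linarith

theorem inner_le_opNorm_mul_sq (S : X →L[ℝ] X) (v : X) : ⟪S v, v⟫ ≤ ‖S‖ * ‖v‖ ^ 2 := by
  refine (real_inner_le_norm _ _).trans ?_
  rw [pow_two, ← mul_assoc]
  gcongr
  exact S.le_opNorm v

theorem primalDualEnergy_le (A : X →L[ℝ] Y) (Tinv : X →L[ℝ] X) (Sginv : Y →L[ℝ] Y)
    {y z z' : Y} {d : X} {D : ℝ} (hy : ‖z' - y‖ ≤ D) (hz : ‖z' - z‖ ≤ D) :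
    primalDualEnergy A Tinv Sginv y d z z'
      ≤ ‖Tinv‖ * ‖d‖ ^ 2 + ‖Sginv‖ * D ^ 2 + D * (‖A‖ * ‖d‖) := by
  have h₁ := inner_le_opNorm_mul_sq Tinv d
  have h₂ : ⟪Sginv (z' - y), z' - y⟫ ≤ ‖Sginv‖ * D ^ 2 := (inner_le_opNorm_mul_sq Sginv _).trans (by gcongr)
  have h₃ : ⟪Sginv (z' - z), z' - z⟫ ≤ ‖Sginv‖ * D ^ 2 := (inner_le_opNorm_mul_sq Sginv _).trans (by gcongr)
  have h₄ : -⟪z' - z, A d⟫ ≤ D * (‖A‖ * ‖d‖) := by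
    refine (neg_le_abs _).trans ((abs_real_inner_le_norm _ _).trans ?_)
    gcongr
    · exact (norm_nonneg _).trans hz
    · exact A.le_opNorm d
  have h₅ : 0 ≤ ‖Tinv‖ * ‖d‖ ^ 2 := by positivity
  rw [primalDualEnergy]
  linarith

/-- A discrete Gronwall-type estimate. -/
theorem le_linear_of_sq_le_sum {u : ℕ → ℝ} {a b c δ : ℝ} (ha : 0 ≤ a)
    (hb : 0 ≤ b) (hc : 0 ≤ c) (hδ : 0 ≤ δ)
    (h : ∀ N : ℕ, 1 ≤ N →
      u N ^ 2 ≤ a + b * (N * δ) + c * δ * ∑ j ∈ Finset.range N, u (j + 1)) :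
    ∀ N : ℕ, 1 ≤ N → u N ≤ (1 + a + b + c) * (1 + N * δ) := by
  intro N
  induction N using Nat.strong_induction_on with
  | _ N ih =>
    intro hN
    by_contra! hlt
    have hNδ : 0 ≤ N * δ := by positivity
    have hsum : ∑ j ∈ Finset.range N, u (j + 1) ≤ N * u N := by
      suffices ∑ j ∈ Finset.range N, u (j + 1) ≤ (Finset.range N).card • u N by simpa using this
      refine Finset.sum_le_card_nsmul _ _ _ fun j hj => ?_
      have hj' : j + 1 ≤ N := Finset.mem_range.1 hj
      rcases hj'.eq_or_lt with hj' | hj'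
      · rw [hj']
      · refine (ih (j + 1) hj' (Nat.le_add_left 1 j)).trans (le_trans ?_ hlt.le)
        gcongr
    have hone : 1 ≤ u N := by nlinarith [mul_nonneg ha hNδ, mul_nonneg hb hNδ, mul_nonneg hc hNδ]
    have hN' := (h N hN).trans (by gcongr :
      _ ≤ a + b * (N * δ) + c * δ * (N * u N))
    have hle : u N * u N ≤ (a + b * (N * δ) + c * (N * δ)) * u N := by
      nlinarith [mul_nonneg ha (sub_nonneg.2 hone),
        mul_nonneg (mul_nonneg hb hNδ) (sub_nonneg.2 hone)]
    have := le_of_mul_le_mul_right hle (by linarith)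
    nlinarith [mul_nonneg ha hNδ]

end PrimalDual

section PrimalDualRate

variable {X Y : Type*} [NormedAddCommGroup X] [InnerProductSpace ℝ X] [CompleteSpace X]
  [NormedAddCommGroup Y] [InnerProductSpace ℝ Y] [CompleteSpace Y]

theorem primalDualEnergy_sum {A : X →L[ℝ] Y} {Tinv : X →L[ℝ] X} {Sg Sginv : Y →L[ℝ] Y}
    (hTsym : ∀ u v, ⟪Tinv u, v⟫ = ⟪u, Tinv v⟫) (hSsym : ∀ u v, ⟪Sginv u, v⟫ = ⟪u, Sginv v⟫)
    (hSginv : ∀ v, Sginv (Sg v) = v)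
    (hcross : ∀ v d, |⟪v, A d⟫| ≤ 1 / 2 * ⟪Tinv d, d⟫ + 1 / 2 * ⟪Sginv v, v⟫)
    {x : ℕ → X} {z : ℕ → Y} {xstar : X} {b : Y} {r ε : ℕ → ℝ}
    (hz : ∀ k, z (k + 1) = z k + Sg (A (x k) - b))
    (hr : ∀ k, r (k + 1) ≤ ⟪-(Tinv (x (k + 1) - x k))
      - ContinuousLinearMap.adjoint A ((2 : ℝ) • z (k + 1) - z k), x (k + 1) - xstar⟫ + ε (k + 1))
    (y : Y) (N : ℕ) :
    ∑ j ∈ Finset.range N, (r (j + 1) + ⟪y, A (x (j + 1)) - b⟫ - ⟪z (j + 2), A xstar - b⟫)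
        + primalDualEnergy A Tinv Sginv y (x N - xstar) (z N) (z (N + 1))
      ≤ primalDualEnergy A Tinv Sginv y (x 0 - xstar) (z 0) (z 1)
        + ∑ j ∈ Finset.range N, ε (j + 1) := by
  induction N with
  | zero => simp
  | succ N ih =>
    have hstep := primalDualEnergy_step hTsym hSsym hcross (x := x N) (x' := x (N + 1))
      (xstar := xstar) (z := z N) (z' := z (N + 1)) (z'' := z (N + 2)) (y := y) (b := b)
      (by rw [hz (N + 1), add_sub_cancel_left, hSginv]) (hr N)
    rw [Finset.sum_range_succ, Finset.sum_range_succ]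
    linarith

/-- Convergence rate of the averaged primal iterates under an exact penalization inequality
(`hpen`); `z` is the sequence of dual iterates, shifted by one, and `r j` the excess of the
regularizer at `x j`. -/
theorem exists_primal_dual_rate {A : X →L[ℝ] Y} {Tinv : X →L[ℝ] X} {Sg Sginv : Y →L[ℝ] Y}
    (hTsym : ∀ u v, ⟪Tinv u, v⟫ = ⟪u, Tinv v⟫) (hSsym : ∀ u v, ⟪Sginv u, v⟫ = ⟪u, Sginv v⟫)
    (hSginv : ∀ v, Sginv (Sg v) = v)
    (hcross : ∀ v d, |⟪v, A d⟫| ≤ 1 / 2 * ⟪Tinv d, d⟫ + 1 / 2 * ⟪Sginv v, v⟫)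
    {σ : ℝ} (hσ : 0 < σ) (hS : ∀ v, ‖v‖ ^ 2 ≤ σ * ⟪Sginv v, v⟫)
    {κ C C₀ : ℝ} (hκ : 0 < κ) (hC : 0 ≤ C) (hC₀ : 0 ≤ C₀) (xstar x₀ : X) (z₀ : Y) :
    ∃ K₁ K₂ K₃ : ℝ, 0 ≤ K₁ ∧ 0 ≤ K₂ ∧ 0 ≤ K₃ ∧
      ∀ δ : ℝ, 0 ≤ δ → δ ≤ 1 → ∀ b : Y, ‖b - A xstar‖ ≤ δ →
      ∀ ε : ℕ → ℝ, (∀ k, ε k ≤ C₀ * δ) →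
      ∀ (x : ℕ → X) (z : ℕ → Y) (r : ℕ → ℝ), x 0 = x₀ → z 0 = z₀ →
      (∀ k, z (k + 1) = z k + Sg (A (x k) - b)) →
      (∀ k, r (k + 1) ≤ ⟪-(Tinv (x (k + 1) - x k))
        - ContinuousLinearMap.adjoint A ((2 : ℝ) • z (k + 1) - z k), x (k + 1) - xstar⟫
          + ε (k + 1)) →
      ∀ xhat : ℕ → X, (∀ N : ℕ, (N : ℝ) • xhat N = ∑ j ∈ Finset.range N, x (j + 1)) →
      (∀ N : ℕ, 1 ≤ N → N * (κ * ‖xhat N - xstar‖) ≤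
        ∑ j ∈ Finset.range N, r (j + 1) + N * (C * ‖A (xhat N) - A xstar‖)) →
      ∀ N : ℕ, 1 ≤ N → ‖xhat N - xstar‖ ≤ K₁ / N + K₂ * δ + K₃ * δ ^ 2 * N := by
  set D := ‖z₀‖ + ‖Sg‖ * (‖A (x₀ - xstar)‖ + 1) + C with hD
  have hD0 : 0 ≤ D := by positivity
  set K := ‖Tinv‖ * ‖x₀ - xstar‖ ^ 2 + ‖Sginv‖ * D ^ 2 + D * (‖A‖ * ‖x₀ - xstar‖) with hK
  have hK0 : 0 ≤ K := by positivity
  set B := 1 + (4 * σ * K + 2 * C ^ 2) + 4 * σ * (C₀ + C) + 4 * σ with hB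
  have hB0 : 0 ≤ B := by positivity
  refine ⟨K / κ, (C₀ + C + B) / κ, B / κ, by positivity, by positivity, by positivity, ?_⟩
  intro δ hδ0 hδ1 b hb ε hε x z r hx0 hz0 hz hr xhat hxhat hpen
  have hb' : ‖A xstar - b‖ ≤ δ := by rwa [norm_sub_rev]
  have key : ∀ N : ℕ, 1 ≤ N → ∃ y : Y, ‖y‖ ≤ C ∧
      N * (κ * ‖xhat N - xstar‖) + 1 / 2 * ⟪Sginv (z (N + 1) - y), z (N + 1) - y⟫
        ≤ K + (C₀ + C) * (N * δ) + δ * ∑ j ∈ Finset.range N, ‖z (j + 2)‖ := by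
    intro N hN
    obtain ⟨y, hyC, hy⟩ : ∃ y : Y, ‖y‖ ≤ C ∧
        ⟪y, A (xhat N) - A xstar⟫ = C * ‖A (xhat N) - A xstar‖ := by
      refine ⟨(C / ‖A (xhat N) - A xstar‖) • (A (xhat N) - A xstar), ?_, ?_⟩
      · rw [norm_smul, norm_div, norm_norm, Real.norm_of_nonneg hC]
        rcases eq_or_ne ‖A (xhat N) - A xstar‖ 0 with h0 | h0
        · rwa [h0, mul_zero]
        · rw [div_mul_cancel₀ _ h0]
      · rw [real_inner_smul_left, real_inner_self_eq_norm_sq]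
        rcases eq_or_ne ‖A (xhat N) - A xstar‖ 0 with h0 | h0
        · rw [h0]; ring
        · field_simp
    refine ⟨y, hyC, ?_⟩
    have hz1 : ‖z 1 - z 0‖ ≤ ‖Sg‖ * (‖A (x₀ - xstar)‖ + 1) := by
      rw [hz 0, add_sub_cancel_left, hx0]
      refine (Sg.le_opNorm _).trans ?_
      gcongr
      calc ‖A x₀ - b‖ = ‖A (x₀ - xstar) + (A xstar - b)‖ := by rw [map_sub]; congr 1; abel
        _ ≤ ‖A (x₀ - xstar)‖ + 1 := (norm_add_le _ _).trans (by gcongr; exact hb'.trans hδ1)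
    have hE₀ : primalDualEnergy A Tinv Sginv y (x 0 - xstar) (z 0) (z 1) ≤ K := by
      rw [hK, ← hx0]
      refine primalDualEnergy_le A Tinv Sginv ?_ ?_
      · calc ‖z 1 - y‖ = ‖(z 0 + (z 1 - z 0)) - y‖ := by congr 1; abel
          _ ≤ ‖z 0‖ + ‖z 1 - z 0‖ + ‖y‖ :=
            (norm_sub_le _ _).trans (by gcongr; exact norm_add_le _ _)
          _ ≤ D := by rw [hz0]; rw [hz0] at hz1; linarith
      · linarith [norm_nonneg z₀]
    have hsum := primalDualEnergy_sum hTsym hSsym hSginv hcross hz hr y N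
    have hE := inner_le_primalDualEnergy hcross y (x N - xstar) (z N) (z (N + 1))
    have hεsum : ∑ j ∈ Finset.range N, ε (j + 1) ≤ N * (C₀ * δ) := by
      simpa using Finset.sum_le_card_nsmul (Finset.range N) (fun j => ε (j + 1)) (C₀ * δ)
        fun j _ => hε _
    have hterm : ∑ j ∈ Finset.range N, (r (j + 1) + ⟪y, A (x (j + 1)) - A xstar⟫
          - δ * (C + ‖z (j + 2)‖))
        ≤ ∑ j ∈ Finset.range N,
          (r (j + 1) + ⟪y, A (x (j + 1)) - b⟫ - ⟪z (j + 2), A xstar - b⟫) := by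
      refine Finset.sum_le_sum fun j _ => ?_
      have h₁ : ⟪y, A (x (j + 1)) - b⟫
          = ⟪y, A (x (j + 1)) - A xstar⟫ + ⟪y, A xstar - b⟫ := by
        rw [← inner_add_right, sub_add_sub_cancel]
      have h₂ : |⟪y, A xstar - b⟫| ≤ C * δ :=
        (abs_real_inner_le_norm _ _).trans (by gcongr)
      have h₃ : |⟪z (j + 2), A xstar - b⟫| ≤ ‖z (j + 2)‖ * δ :=
        (abs_real_inner_le_norm _ _).trans (by gcongr)
      have h₄ := neg_le_of_abs_le h₂
      have h₅ := le_of_abs_le h₃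
      rw [h₁]
      linarith
    have hav : ∑ j ∈ Finset.range N, ⟪y, A (x (j + 1)) - A xstar⟫
        = N * (C * ‖A (xhat N) - A xstar‖) := by
      rw [← hy, ← inner_sum, Finset.sum_sub_distrib, ← map_sum, ← hxhat, map_smul,
        Finset.sum_const, Finset.card_range, ← Nat.cast_smul_eq_nsmul ℝ, ← smul_sub,
        real_inner_smul_right]
    rw [Finset.sum_sub_distrib, Finset.sum_add_distrib, hav, ← Finset.mul_sum,
      Finset.sum_add_distrib, Finset.sum_const, Finset.card_range, nsmul_eq_mul] at hterm
    linarith [hpen N hN]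
  have hgrowth : ∀ N : ℕ, 1 ≤ N → ‖z (N + 1)‖ ≤ B * (1 + N * δ) := by
    refine le_linear_of_sq_le_sum (u := fun N => ‖z (N + 1)‖) (by positivity) (by positivity)
      (by positivity) hδ0 fun N hN => ?_
    obtain ⟨y, hyC, hy⟩ := key N hN
    have h₁ : ‖z (N + 1)‖ ^ 2 ≤ 2 * ‖z (N + 1) - y‖ ^ 2 + 2 * C ^ 2 := by
      have h₂ : ‖z (N + 1)‖ ≤ ‖z (N + 1) - y‖ + C := by
        linarith [norm_le_norm_sub_add (z (N + 1)) y]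
      have h₃ := pow_le_pow_left₀ (norm_nonneg _) h₂ 2
      nlinarith [sq_nonneg (‖z (N + 1) - y‖ - C)]
    have h₂ := hS (z (N + 1) - y)
    have h₃ : 0 ≤ N * (κ * ‖xhat N - xstar‖) := by positivity
    have h₄ : ⟪Sginv (z (N + 1) - y), z (N + 1) - y⟫
        ≤ 2 * (K + (C₀ + C) * (N * δ) + δ * ∑ j ∈ Finset.range N, ‖z (j + 2)‖) := by linarith
    have h₅ := mul_le_mul_of_nonneg_left h₄ hσ.le
    change _ ≤ _ + _ + _ * ∑ j ∈ Finset.range N, ‖z (j + 2)‖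
    linarith
  intro N hN
  obtain ⟨y, -, hy⟩ := key N hN
  have hNpos : (0 : ℝ) < N := Nat.cast_pos.2 hN
  have h₁ : 0 ≤ ⟪Sginv (z (N + 1) - y), z (N + 1) - y⟫ :=
    nonneg_of_mul_nonneg_right ((sq_nonneg _).trans (hS _)) hσ
  have h₂ : ∑ j ∈ Finset.range N, ‖z (j + 2)‖ ≤ N * (B * (1 + N * δ)) := by
    suffices ∑ j ∈ Finset.range N, ‖z (j + 2)‖
        ≤ (Finset.range N).card • (B * (1 + N * δ)) by simpa using this
    refine Finset.sum_le_card_nsmul _ _ _ fun j hj => ?_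
    refine (hgrowth (j + 1) (Nat.le_add_left 1 j)).trans ?_
    have : j + 1 ≤ N := Finset.mem_range.1 hj
    gcongr
  have h₃ := mul_le_mul_of_nonneg_left h₂ hδ0
  have h₄ : ‖xhat N - xstar‖ * (N * κ)
      ≤ K + (C₀ + C) * (N * δ) + δ * (N * (B * (1 + N * δ))) := by linarith
  refine ((le_div_iff₀ (by positivity)).2 h₄).trans (le_of_eq ?_)
  field_simp
  ring

end PrimalDualRate

/-! ### The `ℓ¹` norm as a real-valued function -/

theorem l1norm_eq_tsum {x : lp (fun _ : ℕ => ℝ) 2} (hx : Summable fun i => |x i|) :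
    l1norm x = ((∑' i, |x i| : ℝ) : EReal) := by
  have h := ENNReal.ofReal_tsum_of_nonneg (fun i => abs_nonneg (x i)) hx
  have h' : ∀ i, ENNReal.ofReal |x i| = (‖x i‖₊ : ℝ≥0∞) := fun i => ofReal_norm (x i)
  simp only [h'] at h
  rw [l1norm, ← h, EReal.coe_ennreal_ofReal, max_eq_left (tsum_nonneg fun i => abs_nonneg _)]

theorem summable_of_l1norm_ne_top {x : lp (fun _ : ℕ => ℝ) 2} (hx : l1norm x ≠ ⊤) :
    Summable fun i => |x i| := by
  have h : ∑' i : ℕ, (‖x i‖₊ : ℝ≥0∞) ≠ ⊤ := fun h => hx (by rw [l1norm, h, EReal.coe_ennreal_top])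
  exact NNReal.summable_coe.2 (ENNReal.tsum_coe_ne_top_iff_summable.1 h)

theorem summable_of_mem_epsSubdiff {x x' u : lp (fun _ : ℕ => ℝ) 2} {ε : ℝ}
    (hu : u ∈ epsSubdiff l1norm ε x) (hx' : Summable fun i => |x' i|) :
    Summable fun i => |x i| := by
  refine summable_of_l1norm_ne_top fun htop => ?_
  have h := hu x'
  rw [htop, EReal.top_add_coe, l1norm_eq_tsum hx'] at h
  exact EReal.coe_ne_top _ (top_le_iff.1 h)

theorem tsum_abs_sub_le_of_mem_epsSubdiff {x x' u : lp (fun _ : ℕ => ℝ) 2} {ε : ℝ}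
    (hu : u ∈ epsSubdiff l1norm ε x) (hx' : Summable fun i => |x' i|) :
    ∑' i, |x i| - ∑' i, |x' i| ≤ ⟪u, x - x'⟫ + ε := by
  have h := hu x'
  rw [l1norm_eq_tsum (summable_of_mem_epsSubdiff hu hx'), l1norm_eq_tsum hx', ← EReal.coe_add,
    EReal.coe_le_coe_iff, ← neg_sub x x', inner_neg_right] at h
  linarith

theorem summable_abs_and_tsum_le_of_smul_eq_sum {v : ℕ → lp (fun _ : ℕ => ℝ) 2} {N : ℕ}
    (hN : 1 ≤ N) {a : lp (fun _ : ℕ => ℝ) 2} (ha : (N : ℝ) • a = ∑ j ∈ Finset.range N, v j)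
    (hv : ∀ j, Summable fun i => |v j i|) :
    (Summable fun i => |a i|) ∧ N * ∑' i, |a i| ≤ ∑ j ∈ Finset.range N, ∑' i, |v j i| := by
  have hNpos : (0 : ℝ) < N := Nat.cast_pos.2 hN
  have hpt : ∀ i, N * |a i| ≤ ∑ j ∈ Finset.range N, |v j i| := fun i => by
    have h : (N : ℝ) * a i = ∑ j ∈ Finset.range N, v j i := by
      have := congrArg (fun w : lp (fun _ : ℕ => ℝ) 2 => w i) ha
      rwa [lp.coeFn_sum, Finset.sum_apply] at this
    rw [← abs_of_pos hNpos, ← abs_mul, h]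
    exact Finset.abs_sum_le_sum_abs _ _
  have hsum : Summable fun i => ∑ j ∈ Finset.range N, |v j i| := summable_sum fun j _ => hv j
  have hNa : Summable fun i => N * |a i| :=
    Summable.of_nonneg_of_le (fun i => by positivity) hpt hsum
  refine ⟨(summable_mul_left_iff hNpos.ne').1 hNa, ?_⟩
  rw [← tsum_mul_left, ← Summable.tsum_finsetSum fun j _ => hv j]
  exact hNa.tsum_le_tsum hpt hsum

/-- Under the compressed sensing assumption, `x*` is the unique `ℓ¹`-minimizer
over `{x : A x = b*}` and the averaged primal iterates of the primal–dual algorithm (with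
`R = ‖·‖₁`, `F = 0`) applied to noisy data satisfy an explicit recovery bound, with constants
independent of `k` and of `δ`. -/
theorem statement_6 {Y : Type*}
    [NormedAddCommGroup Y] [InnerProductSpace ℝ Y] [CompleteSpace Y]
    (A : lp (fun _ : ℕ => ℝ) 2 →L[ℝ] Y) (bstar : Y)
    (s : ℕ) (xstar : lp (fun _ : ℕ => ℝ) 2)
    (hxs : A xstar = bstar) (hsupp : SuppLe xstar s)
    (θs θss θs2s : ℝ) (hθ1 : 0 ≤ θs) (hθ2 : 0 ≤ θss) (hθ3 : 0 ≤ θs2s)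
    (hsum : θs + θss + θs2s < 1)
    (hRIP : ∀ x : lp (fun _ : ℕ => ℝ) 2, SuppLe x s →
      (1 - θs) * ‖x‖ ^ 2 ≤ ‖A x‖ ^ 2 ∧ ‖A x‖ ^ 2 ≤ (1 + θs) * ‖x‖ ^ 2)
    (horth1 : ∀ x x' : lp (fun _ : ℕ => ℝ) 2, SuppLe x s → SuppLe x' s →
      Disjoint {i : ℕ | x i ≠ 0} {i : ℕ | x' i ≠ 0} →
      |⟪A x, A x'⟫| ≤ θss * ‖x‖ * ‖x'‖)
    (horth2 : ∀ x x' : lp (fun _ : ℕ => ℝ) 2, SuppLe x s → SuppLe x' (2 * s) →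
      Disjoint {i : ℕ | x i ≠ 0} {i : ℕ | x' i ≠ 0} →
      |⟪A x, A x'⟫| ≤ θs2s * ‖x‖ * ‖x'‖)
    (T Tinv : lp (fun _ : ℕ => ℝ) 2 →L[ℝ] lp (fun _ : ℕ => ℝ) 2) (Sg Sginv : Y →L[ℝ] Y)
    (hTinv : ∀ u, Tinv (T u) = u) (hTinv' : ∀ u, T (Tinv u) = u)
    (hSginv : ∀ v, Sginv (Sg v) = v) (hSginv' : ∀ v, Sg (Sginv v) = v)
    (hTsa : ∀ u v : lp (fun _ : ℕ => ℝ) 2, ⟪T u, v⟫ = ⟪u, T v⟫)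
    (hSgsa : ∀ u v : Y, ⟪Sg u, v⟫ = ⟪u, Sg v⟫)
    (τm τM σm σM : ℝ) (hτm : 0 < τm) (hττ : τm ≤ τM) (hσm : 0 < σm) (hσσ : σm ≤ σM)
    (hTb : ∀ u : lp (fun _ : ℕ => ℝ) 2, τm * ‖u‖ ^ 2 ≤ ⟪T u, u⟫ ∧ ⟪T u, u⟫ ≤ τM * ‖u‖ ^ 2)
    (hSgb : ∀ v : Y, σm * ‖v‖ ^ 2 ≤ ⟪Sg v, v⟫ ∧ ⟪Sg v, v⟫ ≤ σM * ‖v‖ ^ 2)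
    (hω : 0 ≤ 1 - τM * σM * ‖A‖ ^ 2)
    (ξ η : ℝ) (hξ0 : 0 < ξ) (hξ1 : ξ < 1) (hη : 1 < η)
    (hθcond : 0 ≤ ξ - τM * σM * ‖A‖ ^ 2)
    (hρ : 0 < σm * (η - 1) - σM * ξ * η)
    (C₀ : ℝ) (hC₀ : 0 ≤ C₀)
    (x₀ : lp (fun _ : ℕ => ℝ) 2) (ym1 : Y) :
    (∀ x : lp (fun _ : ℕ => ℝ) 2, A x = bstar →
      l1norm xstar ≤ l1norm x ∧ (l1norm x ≤ l1norm xstar → x = xstar)) ∧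
    ∃ c₁ c₂ c₃ c₄ c₅ c₆ c₇ c₈ c₉ : ℝ,
      0 ≤ c₁ ∧ 0 ≤ c₂ ∧ 0 ≤ c₃ ∧ 0 ≤ c₄ ∧ 0 ≤ c₅ ∧ 0 ≤ c₆ ∧ 0 ≤ c₇ ∧ 0 ≤ c₈ ∧ 0 ≤ c₉ ∧
      ∀ δ : ℝ, 0 ≤ δ → δ ≤ 1 →
      ∀ bδ : Y, ‖bδ - bstar‖ ≤ δ →
      ∀ ε : ℕ → ℝ, (∀ k, 0 ≤ ε k ∧ ε k ≤ C₀ * δ) →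
      ∀ x : ℕ → lp (fun _ : ℕ => ℝ) 2, ∀ y : ℕ → Y,
        x 0 = x₀ →
        y 0 = ym1 + Sg (A x₀ - bδ) →
        (∀ k : ℕ,
          -(Tinv (x (k + 1) - x k))
              - ContinuousLinearMap.adjoint A
                  ((2 : ℝ) • y k - (if k = 0 then ym1 else y (k - 1)))
            ∈ epsSubdiff l1norm (ε (k + 1)) (x (k + 1))) →
        (∀ k : ℕ, y (k + 1) = y k + Sg (A (x (k + 1)) - bδ)) →
        ∀ k : ℕ, 1 ≤ k →
          ‖(k : ℝ)⁻¹ • (∑ j ∈ Finset.Icc 1 k, x j) - xstar‖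
            ≤ (1 / Real.sqrt (1 - θs)) *
                Real.sqrt (c₁ / k + c₂ * δ + c₃ * δ ^ ((3 : ℝ) / 2) * Real.sqrt k
                  + c₄ * δ ^ 2 * k + c₅ * δ ^ 2)
              + ((1 + (1 / Real.sqrt (1 - θs)) * ‖A‖) / (1 - θss / (1 - θs - θs2s))) *
                  (c₆ / k + c₇ * δ + c₈ * δ ^ ((3 : ℝ) / 2) * Real.sqrt k
                    + c₉ * δ ^ 2 * k) := by
  have horth : ∀ x x' : lp (fun _ : ℕ => ℝ) 2, SuppLe x s → SuppLe x' s →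
      Disjoint {i : ℕ | x i ≠ 0} {i : ℕ | x' i ≠ 0} →
      |⟪A x, A x'⟫| ≤ min θss θs2s * ‖x‖ * ‖x'‖ := fun x x' hx hx' hd => by
    rcases min_choice θss θs2s with h | h <;> rw [h]
    · exact horth1 x x' hx hx' hd
    · exact horth2 x x' hx ⟨hx'.1, hx'.2.trans (by omega)⟩ hd
  have hmin : θs + 2 * min θss θs2s < 1 := by
    linarith [min_le_left θss θs2s, min_le_right θss θs2s]
  obtain ⟨κ, C, hκ, hC, hpen⟩ := exists_exact_penalty (le_min hθ2 hθ3) hmin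
    (fun x hx => (hRIP x hx).1) horth hsupp
  have hstar : Summable fun i => |xstar i| :=
    summable_of_ne_finset_zero (s := hsupp.1.toFinset) fun i hi => by
      rw [abs_eq_zero]
      by_contra hne
      exact hi (hsupp.1.mem_toFinset.2 hne)
  refine ⟨fun x hx => ?_, ?_⟩
  · by_cases htop : l1norm x = ⊤
    · refine ⟨htop ▸ le_top, fun h => ?_⟩
      rw [htop, l1norm_eq_tsum hstar] at h
      exact absurd (top_le_iff.1 h) (EReal.coe_ne_top _)
    have hxsum := summable_of_l1norm_ne_top htop
    have h := hpen x hxsum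
    rw [hx, hxs, sub_self, norm_zero, mul_zero, add_zero] at h
    rw [l1norm_eq_tsum hstar, l1norm_eq_tsum hxsum, EReal.coe_le_coe_iff, EReal.coe_le_coe_iff]
    refine ⟨by linarith [mul_nonneg hκ.le (norm_nonneg (x - xstar))], fun hle => ?_⟩
    have h0 : ‖x - xstar‖ ≤ 0 := le_of_mul_le_mul_left (by linarith) hκ
    exact sub_eq_zero.1 (norm_le_zero_iff.1 h0)
  have hτM : 0 < τM := hτm.trans_le hττ
  have hσM : 0 < σM := hσm.trans_le hσσ
  have hTn : ∀ d, ‖d‖ ^ 2 ≤ τM * ⟪Tinv d, d⟫ := norm_sq_le_mul_inner_inverse hTinv' hTsa hτM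
    fun u => ⟨(mul_nonneg hτm.le (sq_nonneg _)).trans (hTb u).1, (hTb u).2⟩
  have hSn : ∀ v, ‖v‖ ^ 2 ≤ σM * ⟪Sginv v, v⟫ := norm_sq_le_mul_inner_inverse hSginv' hSgsa hσM
    fun u => ⟨(mul_nonneg hσm.le (sq_nonneg _)).trans (hSgb u).1, (hSgb u).2⟩
  obtain ⟨K₁, K₂, K₃, hK₁, hK₂, hK₃, hrate⟩ := exists_primal_dual_rate
    (inner_inverse_symm hTinv' hTsa) (inner_inverse_symm hSginv' hSgsa) hSginv
    (abs_inner_le_half_add_half hτM hσM (by linarith) hTn hSn) hσM hSn hκ hC hC₀ xstar x₀ ym1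
  set P := (1 + (1 / Real.sqrt (1 - θs)) * ‖A‖) / (1 - θss / (1 - θs - θs2s)) with hP
  have hP0 : 0 < P := by
    have hM : θss / (1 - θs - θs2s) < 1 := by rw [div_lt_one (by linarith)]; linarith
    exact div_pos (by positivity) (by linarith)
  refine ⟨0, 0, 0, 0, 0, K₁ / P, K₂ / P, 0, K₃ / P, le_rfl, le_rfl, le_rfl, le_rfl, le_rfl,
    by positivity, by positivity, le_rfl, by positivity, ?_⟩
  intro δ hδ0 hδ1 bδ hbδ ε hε x y hx0 hy0 hsub hy k hk
  have hvsum : ∀ j, Summable fun i => |x (j + 1) i| := fun j =>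
    summable_of_mem_epsSubdiff (hsub j) hstar
  have hIcc : ∀ N : ℕ, ∑ j ∈ Finset.Icc 1 N, x j = ∑ j ∈ Finset.range N, x (j + 1) := fun N => by
    induction N with
    | zero => simp
    | succ N ih => rw [Finset.sum_Icc_succ_top (by omega), ih, Finset.sum_range_succ]
  have hxhat : ∀ N : ℕ, (N : ℝ) • ((N : ℝ)⁻¹ • ∑ j ∈ Finset.Icc 1 N, x j)
      = ∑ j ∈ Finset.range N, x (j + 1) := fun N => by
    rcases N.eq_zero_or_pos with rfl | hN
    · simp
    · rw [hIcc, smul_inv_smul₀ (Nat.cast_ne_zero.2 hN.ne')]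
  have hbound := hrate δ hδ0 hδ1 bδ (by rwa [hxs]) ε (fun j => (hε j).2) x
    (fun j => if j = 0 then ym1 else y (j - 1)) (fun j => ∑' i, |x j i| - ∑' i, |xstar i|)
    hx0 (if_pos rfl) ?_ (fun j => ?_) (fun N => (N : ℝ)⁻¹ • ∑ j ∈ Finset.Icc 1 N, x j) hxhat
    (fun N hN => ?_) k hk
  · refine hbound.trans (le_of_eq ?_)
    simp only [zero_mul, zero_div, add_zero, Real.sqrt_zero, mul_zero, zero_add]
    field_simp
  · rintro (_ | j)
    · simpa [hx0] using hy0
    · simpa using hy j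
  · simpa using tsum_abs_sub_le_of_mem_epsSubdiff (hsub j) hstar
  · obtain ⟨hsum, hle⟩ := summable_abs_and_tsum_le_of_smul_eq_sum hN (hxhat N) hvsum
    have h := mul_le_mul_of_nonneg_left (hpen _ hsum) (Nat.cast_nonneg (α := ℝ) N)
    rw [Finset.sum_sub_distrib, Finset.sum_const, Finset.card_range, nsmul_eq_mul]
    linarith
end
end

section
/- Let the primal–dual algorithm be run with data b ∈ Y, with initialization y₋₁ = y₀, summable errors ∑_k ε_k < ∞, and ω := 1 − τ_M(L + σ_M‖A‖²) ≥ 0. Then every weak cluster point of the averaged sequence (x̂_k, ŷ_k) is a saddle point of the Lagrangian L_b. In particular, if L_b has no saddle points, then ‖x̂_k‖ + ‖ŷ_k‖ → +∞. -/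
open scoped RealInnerProductSpace ENNReal NNReal
open Filter Topology

noncomputable section

section GradientInequalities

variable {X : Type*} [NormedAddCommGroup X] [InnerProductSpace ℝ X] [CompleteSpace X]

lemma HasGradientAt.hasDerivAt_comp_line {F : X → ℝ} {g u d : X} {t : ℝ}
    (h : HasGradientAt F g (u + t • d)) :
    HasDerivAt (fun s : ℝ => F (u + s • d)) ⟪g, d⟫ t := by
  have h1 : HasDerivAt (fun s : ℝ => u + s • d) d t := by
    simpa using ((hasDerivAt_id t).smul_const d).const_add u
  have h2 := h.hasFDerivAt.comp_hasDerivAt t h1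
  rwa [InnerProductSpace.toDual_apply_apply] at h2

/-- A convex function lies above its tangent hyperplanes. -/
lemma ConvexOn.add_inner_gradient_le {F : X → ℝ} (hF : ConvexOn ℝ Set.univ F) {g u : X}
    (hg : HasGradientAt F g u) (v : X) : F u + ⟪g, v - u⟫ ≤ F v := by
  have hc : ConvexOn ℝ Set.univ (fun s : ℝ => F (u + s • (v - u))) := by
    have h := hF.comp_affineMap (AffineMap.lineMap (k := ℝ) u v)
    simpa [Function.comp_def, AffineMap.lineMap_apply, add_comm] using h
  have hd : HasDerivAt (fun s : ℝ => F (u + s • (v - u))) ⟪g, v - u⟫ 0 :=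
    HasGradientAt.hasDerivAt_comp_line (by simpa using hg)
  have h := hc.le_slope_of_hasDerivAt (Set.mem_univ 0) (Set.mem_univ 1) one_pos hd
  simp [slope_def_field] at h
  linarith

/-- The descent lemma for functions with Lipschitz gradient. -/
lemma le_add_inner_gradient_add_sq {F : X → ℝ} {F' : X → X} {L : ℝ}
    (hF : ∀ u, HasGradientAt F (F' u) u) (hL : ∀ u v, ‖F' u - F' v‖ ≤ L * ‖u - v‖) (u v : X) :
    F v ≤ F u + ⟪F' u, v - u⟫ + L / 2 * ‖v - u‖ ^ 2 := by
  set d := v - u with hd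
  have hder : ∀ t : ℝ, HasDerivAt
      (fun s : ℝ => F (u + s • d) - (s * ⟪F' u, d⟫ + L / 2 * ‖d‖ ^ 2 * s ^ 2))
      (⟪F' (u + t • d), d⟫ - (⟪F' u, d⟫ + L * ‖d‖ ^ 2 * t)) t := by
    intro t
    have h1 := (hF (u + t • d)).hasDerivAt_comp_line
    have h2 : HasDerivAt (fun s : ℝ => s * ⟪F' u, d⟫ + L / 2 * ‖d‖ ^ 2 * s ^ 2)
        (⟪F' u, d⟫ + L * ‖d‖ ^ 2 * t) t := by
      have h3 := ((hasDerivAt_id t).mul_const ⟪F' u, d⟫).add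
        ((hasDerivAt_pow 2 t).const_mul (L / 2 * ‖d‖ ^ 2))
      refine h3.congr_deriv ?_
      simp
      ring
    exact h1.sub h2
  have hanti := antitoneOn_of_deriv_nonpos (convex_Icc (0 : ℝ) 1)
    (fun t _ => (hder t).continuousAt.continuousWithinAt)
    (fun t _ => (hder t).differentiableAt.differentiableWithinAt)
    (fun t ht => by
      rw [interior_Icc] at ht
      rw [(hder t).deriv]
      have h1 : ⟪F' (u + t • d) - F' u, d⟫ ≤ L * ‖t • d‖ * ‖d‖ :=
        (real_inner_le_norm _ _).trans
          (mul_le_mul_of_nonneg_right (by simpa using hL (u + t • d) u) (norm_nonneg _))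
      rw [inner_sub_left, norm_smul, Real.norm_of_nonneg ht.1.le] at h1
      nlinarith)
  have h := hanti (Set.left_mem_Icc.2 zero_le_one) (Set.right_mem_Icc.2 zero_le_one) zero_le_one
  simp [hd] at h
  linarith

end GradientInequalities

section PositiveOperators

variable {X Y : Type*} [NormedAddCommGroup X] [InnerProductSpace ℝ X]
  [NormedAddCommGroup Y] [InnerProductSpace ℝ Y]

lemma inner_rightInverse_comm {T Tinv : X →L[ℝ] X} (hinv : ∀ u, T (Tinv u) = u)
    (hsa : ∀ u v : X, ⟪T u, v⟫ = ⟪u, T v⟫) (u v : X) : ⟪Tinv u, v⟫ = ⟪u, Tinv v⟫ := by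
  conv_lhs => rw [← hinv v, ← hsa, hinv]

/-- If `0 ≤ T ≤ c` then `‖u‖² ≤ c ⟪T⁻¹ u, u⟫`. -/
lemma norm_sq_le_mul_inner_rightInverse {T Tinv : X →L[ℝ] X} {c : ℝ} (hc : 0 < c)
    (hinv : ∀ u, T (Tinv u) = u) (hsa : ∀ u v : X, ⟪T u, v⟫ = ⟪u, T v⟫)
    (hpos : ∀ u, 0 ≤ ⟪T u, u⟫) (hle : ∀ u, ⟪T u, u⟫ ≤ c * ‖u‖ ^ 2) (u : X) :
    ‖u‖ ^ 2 ≤ c * ⟪Tinv u, u⟫ := by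
  have h1 := hpos (c • Tinv u - u)
  have h2 := hle u
  have h3 : ⟪T u, Tinv u⟫ = ‖u‖ ^ 2 := by rw [hsa, hinv, real_inner_self_eq_norm_sq]
  have h4 : ⟪u, Tinv u⟫ = ⟪Tinv u, u⟫ := real_inner_comm _ _
  simp only [map_sub, map_smul, hinv, inner_sub_left, inner_sub_right, real_inner_smul_left,
    real_inner_smul_right, h3, h4, real_inner_self_eq_norm_sq] at h1
  have h5 : 0 ≤ c * (c * ⟪Tinv u, u⟫ - ‖u‖ ^ 2) := by nlinarith
  linarith [nonneg_of_mul_nonneg_right h5 hc]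

lemma neg_half_mul_norm_sq_le {S : Y →L[ℝ] Y} {A : X →L[ℝ] Y} {c : ℝ} (hc : 0 ≤ c)
    (hsa : ∀ u v : Y, ⟪S u, v⟫ = ⟪u, S v⟫)
    (hpos : ∀ v, 0 ≤ ⟪S v, v⟫) (hle : ∀ v, ⟪S v, v⟫ ≤ c * ‖v‖ ^ 2) (e : Y) (s : X) :
    -(1 / 2 * (c * ‖A‖ ^ 2 * ‖s‖ ^ 2)) ≤ 1 / 2 * ⟪S e, e⟫ + ⟪S e, A s⟫ := by
  have h1 := hpos (e + A s)
  have h2 : c * ‖A s‖ ^ 2 ≤ c * (‖A‖ * ‖s‖) ^ 2 := by gcongr; exact A.le_opNorm s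
  have h3 : ⟪S (A s), e⟫ = ⟪S e, A s⟫ := by rw [hsa, real_inner_comm]
  simp only [map_add, inner_add_left, inner_add_right, h3] at h1
  nlinarith [hle (A s)]

end PositiveOperators

section WeakTopology

variable {X : Type*} [NormedAddCommGroup X] [InnerProductSpace ℝ X] [CompleteSpace X]

/-- Closed convex sets are weakly closed. -/
lemma Convex.mem_of_tendsto_inner {ι : Type*} {l : Filter ι} [l.NeBot] {s : Set X}
    (hs : Convex ℝ s) (hs' : IsClosed s) {u : ι → X} {a : X}
    (hu : ∀ w, Tendsto (fun i => ⟪u i, w⟫) l (𝓝 ⟪a, w⟫)) (hmem : ∀ᶠ i in l, u i ∈ s) :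
    a ∈ s := by
  by_contra ha
  obtain ⟨f, c, hf, hc⟩ := geometric_hahn_banach_closed_point hs hs' ha
  have hfw : ∀ v, ⟪v, (InnerProductSpace.toDual ℝ X).symm f⟫ = f v := fun v => by
    rw [real_inner_comm, InnerProductSpace.toDual_symm_apply]
  have h := hu ((InnerProductSpace.toDual ℝ X).symm f)
  simp only [hfw] at h
  exact hc.not_ge (le_of_tendsto h (hmem.mono fun i hi => (hf _ hi).le))

/-- Bounded families in a Hilbert space converge weakly along ultrafilters. -/
lemma Ultrafilter.exists_tendsto_inner {ι : Type*} (U : Ultrafilter ι) {u : ι → X} {M : ℝ}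
    (hu : ∀ᶠ i in (U : Filter ι), ‖u i‖ ≤ M) :
    ∃ a : X, ∀ w, Tendsto (fun i => ⟪u i, w⟫) U (𝓝 ⟪a, w⟫) := by
  have hK := WeakDual.isCompact_closedBall (𝕜 := ℝ) (E := X) 0 M
  let f : ι → WeakDual ℝ X := fun i =>
    StrongDual.toWeakDual (InnerProductSpace.toDual ℝ X (u i))
  have hmem : WeakDual.toStrongDual ⁻¹' Metric.closedBall (0 : StrongDual ℝ X) M ∈ U.map f := by
    rw [Ultrafilter.mem_map]
    filter_upwards [hu] with i hi
    simpa [f] using hi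
  obtain ⟨a, -, ha⟩ := hK.ultrafilter_le_nhds' _ hmem
  refine ⟨(InnerProductSpace.toDual ℝ X).symm (WeakDual.toStrongDual a), fun w => ?_⟩
  rw [InnerProductSpace.toDual_symm_apply]
  have hf : Tendsto f U (𝓝 a) := ha
  exact ((WeakDual.eval_continuous w).tendsto a).comp hf

end WeakTopology

section ExtendedRealConvexity

variable {X : Type*} [NormedAddCommGroup X] [InnerProductSpace ℝ X]

lemma ERealConvex.convexOn_toReal {R : X → EReal} (hR : ERealConvex R) (hbot : ∀ x, R x ≠ ⊥) :
    ConvexOn ℝ {x | R x ≠ ⊤} (fun x => (R x).toReal) := by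
  have key : ∀ x y : X, R x ≠ ⊤ → R y ≠ ⊤ → ∀ s t : ℝ, 0 ≤ s → 0 ≤ t → s + t = 1 →
      R (s • x + t • y) ≤ ((s * (R x).toReal + t * (R y).toReal : ℝ) : EReal) := by
    intro x y hx hy s t hs ht hst
    obtain rfl : t = 1 - s := by linarith
    have h := hR x y s hs (by linarith)
    rw [← EReal.coe_toReal hx (hbot x), ← EReal.coe_toReal hy (hbot y)] at h
    exact_mod_cast h
  refine ⟨fun x hx y hy s t hs ht hst => ?_, fun x hx y hy s t hs ht hst => ?_⟩
  · exact ((key x y hx hy s t hs ht hst).trans_lt (EReal.coe_lt_top _)).ne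
  · have h := EReal.toReal_le_toReal (key x y hx hy s t hs ht hst) (hbot _) (EReal.coe_ne_top _)
    rwa [EReal.toReal_coe] at h

end ExtendedRealConvexity

lemma LowerSemicontinuous.isClosed_add_coe_le {X : Type*} [TopologicalSpace X]
    {R : X → EReal} (hR : LowerSemicontinuous R)
    {g : X → ℝ} (hg : Continuous g) (c : ℝ) : IsClosed {x | R x + (g x : EReal) ≤ c} := by
  have h : LowerSemicontinuous fun x => R x + (g x : EReal) :=
    hR.add' (continuous_coe_real_ereal.comp hg).lowerSemicontinuous fun x =>
      EReal.continuousAt_add (Or.inr (EReal.coe_ne_bot _)) (Or.inr (EReal.coe_ne_top _))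
  exact h.isClosed_preimage c

section PrimalDual

variable {X Y : Type*} [NormedAddCommGroup X] [InnerProductSpace ℝ X]
  [NormedAddCommGroup Y] [InnerProductSpace ℝ Y]

lemma toReal_add_inner_le_of_mem_epsSubdiff {R : X → EReal} (hbot : ∀ x, R x ≠ ⊥) {ε : ℝ}
    {x g u : X} (hg : g ∈ epsSubdiff R ε x) (hu : R u ≠ ⊤) :
    R x ≠ ⊤ ∧ (R x).toReal + ⟪g, u - x⟫ - ε ≤ (R u).toReal := by
  have h := hg u
  have hx : R x ≠ ⊤ := by
    intro hx
    rw [hx, EReal.top_add_coe] at h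
    exact hu (top_le_iff.1 h)
  refine ⟨hx, ?_⟩
  rw [← EReal.coe_toReal hx (hbot x), ← EReal.coe_toReal hu (hbot u)] at h
  have h' : (R x).toReal + (⟪g, u - x⟫ - ε) ≤ (R u).toReal := by exact_mod_cast h
  linarith

/-- The Lyapunov function of the primal–dual iteration, where `p` and `q` are the primal and dual
offsets from a reference point and `e` is the current constraint residual. -/
def pdEnergy (A : X →L[ℝ] Y) (Tinv : X →L[ℝ] X) (Sg Sginv : Y →L[ℝ] Y) (p : X) (q e : Y) : ℝ :=
  Vfun Tinv Sginv (p, q) + 1 / 2 * ⟪Sg e, e⟫ + ⟪Sg e, A p⟫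

lemma pdEnergy_nonneg {A : X →L[ℝ] Y} {Tinv : X →L[ℝ] X} {Sg Sginv : Y →L[ℝ] Y} {c : ℝ}
    (hTlow : ∀ u, c * ‖u‖ ^ 2 ≤ ⟪Tinv u, u⟫) (hSginv : ∀ v, 0 ≤ ⟪Sginv v, v⟫)
    (hYoung : ∀ (e : Y) (s : X), -(1 / 2 * (c * ‖s‖ ^ 2)) ≤ 1 / 2 * ⟪Sg e, e⟫ + ⟪Sg e, A s⟫)
    (p : X) (q e : Y) : 0 ≤ pdEnergy A Tinv Sg Sginv p q e := by
  have h1 := hTlow p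
  have h2 := hSginv q
  have h3 := hYoung e p
  simp only [pdEnergy, Vfun]
  linarith

variable [CompleteSpace X]

/-- One step of the primal–dual iteration decreases the energy by at least the Lagrangian gap,
up to the subdifferential error. -/
lemma gap_le_pdEnergy_sub [CompleteSpace Y] {A : X →L[ℝ] Y} {b : Y} {R : X → EReal} (hbot : ∀ x, R x ≠ ⊥)
    {F : X → ℝ} {F' : X → X} {L : ℝ} (hFconv : ConvexOn ℝ Set.univ F)
    (hFgrad : ∀ u : X, HasGradientAt F (F' u) u)
    (hFlip : ∀ u v : X, ‖F' u - F' v‖ ≤ L * ‖u - v‖)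
    {Tinv : X →L[ℝ] X} {Sg Sginv : Y →L[ℝ] Y} {c : ℝ}
    (hTinv : ∀ u v : X, ⟪Tinv u, v⟫ = ⟪u, Tinv v⟫)
    (hSginv : ∀ v, Sginv (Sg v) = v) (hSginvsa : ∀ u v : Y, ⟪Sginv u, v⟫ = ⟪u, Sginv v⟫)
    (hTlow : ∀ u, (L + c) * ‖u‖ ^ 2 ≤ ⟪Tinv u, u⟫)
    (hYoung : ∀ (e : Y) (s : X), -(1 / 2 * (c * ‖s‖ ^ 2)) ≤ 1 / 2 * ⟪Sg e, e⟫ + ⟪Sg e, A s⟫)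
    {ε : ℝ} {x x' u : X} {y y' e v : Y} (hu : R u ≠ ⊤)
    (hstep : -(Tinv (x' - x)) - F' x - ContinuousLinearMap.adjoint A (y + Sg e)
      ∈ epsSubdiff R ε x')
    (hdual : y' = y + Sg (A x' - b)) :
    ((R x').toReal + F x' + ⟪v, A x' - b⟫) - ((R u).toReal + F u + ⟪y', A u - b⟫) ≤
      pdEnergy A Tinv Sg Sginv (u - x) (v - y) e
        - pdEnergy A Tinv Sg Sginv (u - x') (v - y') (A x' - b) + ε := by
  have hR := (toReal_add_inner_le_of_mem_epsSubdiff hbot hstep hu).2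
  have hF1 := hFconv.add_inner_gradient_le (hFgrad x) u
  have hF2 := le_add_inner_gradient_add_sq hFgrad hFlip x x'
  have hlow := hTlow (x' - x)
  have hY := hYoung e (x' - x)
  obtain ⟨e', he'⟩ : ∃ e', e' = A x' - b := ⟨_, rfl⟩
  obtain ⟨p, hp⟩ : ∃ p, p = u - x' := ⟨_, rfl⟩
  obtain ⟨s, hs⟩ : ∃ s, s = x' - x := ⟨_, rfl⟩
  obtain ⟨q, hq⟩ : ∃ q, q = v - y' := ⟨_, rfl⟩
  rw [← he'] at hdual
  have hux : u - x = s + p := by rw [hs, hp]; abel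
  have hvy : v - y = q + Sg e' := by rw [hq, hdual]; abel
  have hAu : A u - b = e' + A p := by rw [he', hp, map_sub]; abel
  have hv : v = q + y + Sg e' := by rw [hq, hdual]; abel
  rw [hux] at hF1
  rw [← hs] at hF2 hlow hY hR
  rw [← hp] at hR
  rw [← hq, ← hp, ← he', hux, hvy, hAu, hv, hdual]
  have h1 : ⟪Tinv p, s⟫ = ⟪Tinv s, p⟫ := by rw [hTinv, real_inner_comm]
  have h2 : ⟪Sginv q, Sg e'⟫ = ⟪q, e'⟫ := by rw [hSginvsa, hSginv]
  have h3 : ⟪e', q⟫ = ⟪q, e'⟫ := real_inner_comm _ _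
  have h4 : ⟪e', Sg e'⟫ = ⟪Sg e', e'⟫ := real_inner_comm _ _
  simp only [pdEnergy, Vfun, map_add, hSginv, inner_add_left, inner_add_right, inner_sub_left,
    inner_neg_left, ContinuousLinearMap.adjoint_inner_left, h1, h2, h3, h4] at *
  linarith

/-- If the accumulated Lagrangian gaps of a sequence are bounded relative to every reference point,
then weak limits of its averages are saddle points. -/
lemma isSaddle_of_sum_gap_le {A : X →L[ℝ] Y} {b : Y} {R : X → EReal} (hR : ProperConvexLsc R)
    {F : X → ℝ} (hFconv : ConvexOn ℝ Set.univ F) (hFcont : Continuous F)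
    {x : ℕ → X} {y : ℕ → Y} (hx : ∀ j, 1 ≤ j → R (x j) ≠ ⊤)
    (hgap : ∀ u v, R u ≠ ⊤ → ∃ C : ℝ, ∀ n : ℕ, ∑ j ∈ Finset.Icc 1 n,
      (((R (x j)).toReal + F (x j) + ⟪v, A (x j) - b⟫)
        - ((R u).toReal + F u + ⟪y j, A u - b⟫)) ≤ C)
    {ι : Type*} {l : Filter ι} [l.NeBot] {φ : ι → ℕ} (hφ : Tendsto φ l atTop) {xi : X} {yi : Y}
    (hxi : ∀ w, Tendsto (fun i => ⟪(φ i : ℝ)⁻¹ • ∑ j ∈ Finset.Icc 1 (φ i), x j, w⟫) l (𝓝 ⟪xi, w⟫))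
    (hyi : ∀ w, Tendsto (fun i => ⟪(φ i : ℝ)⁻¹ • ∑ j ∈ Finset.Icc 1 (φ i), y j, w⟫) l (𝓝 ⟪yi, w⟫)) :
    IsSaddle R F A b (xi, yi) := by
  obtain ⟨-, hbot, hconv, hlsc⟩ := hR
  intro u v
  by_cases hu : R u = ⊤
  · simp [Lag, hu]
  obtain ⟨C, hC⟩ := hgap u v hu
  have hcoe : ∀ z w, R z ≠ ⊤ →
      Lag R F A b z w = (((R z).toReal + (F z + ⟪w, A z - b⟫) : ℝ) : EReal) := by
    intro z w hz
    rw [Lag, EReal.coe_add (R z).toReal, EReal.coe_toReal hz (hbot z)]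
  set g : X → ℝ := fun z => F z + ⟪v, A z - b⟫ with hg
  have hgcont : Continuous g := by fun_prop
  have hgconv : ConvexOn ℝ Set.univ g := by
    refine hFconv.add ⟨convex_univ, fun z _ w _ s t _ _ hst => le_of_eq ?_⟩
    have hb : b = s • b + t • b := by rw [← add_smul, hst, one_smul]
    conv_lhs => rw [hb]
    simp only [map_add, map_smul, inner_sub_right, inner_add_right, real_inner_smul_right,
      smul_eq_mul]
    ring
  set D : Set X := {z | R z ≠ ⊤}
  set h : X → ℝ := fun z => (R z).toReal + g z with hh
  have hhconv : ConvexOn ℝ D h :=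
    (hconv.convexOn_toReal hbot).add
      (hgconv.subset (Set.subset_univ _) (hconv.convexOn_toReal hbot).1)
  have hlevel : ∀ (c : ℝ) (z : X), R z + (g z : EReal) ≤ c ↔ z ∈ D ∧ h z ≤ c := by
    intro c z
    by_cases hz : R z = ⊤
    · simp [D, hz]
    · change Lag R F A b z v ≤ c ↔ R z ≠ ⊤ ∧ h z ≤ c
      rw [hcoe z v hz, EReal.coe_le_coe_iff]
      exact (and_iff_right hz).symm
  have hmem : ∀ c : ℝ, (R u).toReal + F u + ⟪yi, A u - b⟫ < c → xi ∈ D ∧ h xi ≤ c := by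
    intro c hc
    have hconvex : Convex ℝ {z | R z + (g z : EReal) ≤ c} := by
      simp only [hlevel]
      exact hhconv.convex_le c
    refine (hlevel c xi).1
      (hconvex.mem_of_tendsto_inner (l := l) (hlsc.isClosed_add_coe_le hgcont c) hxi ?_)
    have hlim : Tendsto (fun i => (R u).toReal + F u
        + ⟪(φ i : ℝ)⁻¹ • ∑ j ∈ Finset.Icc 1 (φ i), y j, A u - b⟫ + (φ i : ℝ)⁻¹ * C) l
        (𝓝 ((R u).toReal + F u + ⟪yi, A u - b⟫ + 0 * C)) :=
      ((hyi (A u - b)).const_add _).add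
        ((tendsto_inv_atTop_zero.comp (tendsto_natCast_atTop_atTop.comp hφ)).mul_const C)
    rw [zero_mul, add_zero] at hlim
    filter_upwards [hlim.eventually (eventually_le_nhds hc), hφ.eventually_ge_atTop 1]
      with i hi hn
    refine (hlevel c _).2 ?_
    generalize φ i = n at hi hn
    have hn0 : (0 : ℝ) < n := by exact_mod_cast hn
    have hsum : ∑ j ∈ Finset.Icc 1 n, (n : ℝ)⁻¹ = 1 := by
      simp [hn0.ne']
    have hxmem : ∀ j ∈ Finset.Icc 1 n, x j ∈ D := fun j hj => hx j (Finset.mem_Icc.1 hj).1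
    have hmemD := hhconv.1.sum_mem (fun _ _ => (inv_pos.2 hn0).le) hsum hxmem
    have hJ := hhconv.map_sum_le (fun _ _ => (inv_pos.2 hn0).le) hsum hxmem
    rw [← Finset.smul_sum] at hmemD hJ
    refine ⟨hmemD, hJ.trans (le_trans ?_ hi)⟩
    have hCn := mul_le_mul_of_nonneg_left (hC n) (inv_pos.2 hn0).le
    rw [Finset.sum_sub_distrib, Finset.sum_add_distrib (g := fun j => ⟪y j, A u - b⟫),
      ← sum_inner, Finset.sum_const, Nat.card_Icc, nsmul_eq_mul, Nat.add_sub_cancel] at hCn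
    simp only [smul_eq_mul, ← Finset.mul_sum, real_inner_smul_left, hh, hg, ← add_assoc]
    have hcancel : (n : ℝ)⁻¹ * (n * ((R u).toReal + F u)) = (R u).toReal + F u := by
      field_simp
    linarith
  change Lag R F A b xi v ≤ Lag R F A b u yi
  rw [hcoe _ _ (hmem _ (lt_add_one _)).1, hcoe _ _ hu, EReal.coe_le_coe_iff, ← add_assoc _ (F u)]
  exact le_of_forall_gt_imp_ge_of_dense fun c hc => (hmem c hc).2

end PrimalDual

variable {X Y : Type*}
  [NormedAddCommGroup X] [InnerProductSpace ℝ X] [CompleteSpace X]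
  [NormedAddCommGroup Y] [InnerProductSpace ℝ Y] [CompleteSpace Y]

/-- With summable errors, every weak cluster point of the averaged
primal–dual sequence is a saddle point of `L_b`; in particular, if `L_b` has no saddle
points then `‖x̂_k‖ + ‖ŷ_k‖ → +∞`. -/
theorem statement_7
    (A : X →L[ℝ] Y) (b : Y)
    (R : X → EReal) (hR : ProperConvexLsc R)
    (F : X → ℝ) (F' : X → X) (L : ℝ) (hL : 0 ≤ L)
    (hFconv : ConvexOn ℝ Set.univ F)
    (hFgrad : ∀ u : X, HasGradientAt F (F' u) u)
    (hFlip : ∀ u v : X, ‖F' u - F' v‖ ≤ L * ‖u - v‖)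
    (T Tinv : X →L[ℝ] X) (Sg Sginv : Y →L[ℝ] Y)
    (hTinv : ∀ u, Tinv (T u) = u) (hTinv' : ∀ u, T (Tinv u) = u)
    (hSginv : ∀ v, Sginv (Sg v) = v) (hSginv' : ∀ v, Sg (Sginv v) = v)
    (hTsa : ∀ u v : X, ⟪T u, v⟫ = ⟪u, T v⟫)
    (hSgsa : ∀ u v : Y, ⟪Sg u, v⟫ = ⟪u, Sg v⟫)
    (τm τM σm σM : ℝ) (hτm : 0 < τm) (hττ : τm ≤ τM) (hσm : 0 < σm) (hσσ : σm ≤ σM)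
    (hTb : ∀ u : X, τm * ‖u‖ ^ 2 ≤ ⟪T u, u⟫ ∧ ⟪T u, u⟫ ≤ τM * ‖u‖ ^ 2)
    (hSgb : ∀ v : Y, σm * ‖v‖ ^ 2 ≤ ⟪Sg v, v⟫ ∧ ⟪Sg v, v⟫ ≤ σM * ‖v‖ ^ 2)
    (hω : 0 ≤ 1 - τM * (L + σM * ‖A‖ ^ 2))
    (ε : ℕ → ℝ) (hε : ∀ k, 0 ≤ ε k) (hεsum : Summable ε)
    (x : ℕ → X) (y : ℕ → Y) (ym1 : Y) (hinit : ym1 = y 0)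
    (hstep : ∀ k : ℕ,
      -(Tinv (x (k + 1) - x k)) - F' (x k)
          - ContinuousLinearMap.adjoint A ((2 : ℝ) • y k - (if k = 0 then ym1 else y (k - 1)))
        ∈ epsSubdiff R (ε (k + 1)) (x (k + 1)))
    (hdual : ∀ k : ℕ, y (k + 1) = y k + Sg (A (x (k + 1)) - b)) :
    (∀ xi : X, ∀ yi : Y,
      (∃ φ : ℕ → ℕ, StrictMono φ ∧
        WeakTendsto (fun j => ((φ j : ℝ))⁻¹ • ∑ i ∈ Finset.Icc 1 (φ j), x i) xi ∧
        WeakTendsto (fun j => ((φ j : ℝ))⁻¹ • ∑ i ∈ Finset.Icc 1 (φ j), y i) yi) →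
      IsSaddle R F A b (xi, yi)) ∧
    ((¬ ∃ p : X × Y, IsSaddle R F A b p) →
      Tendsto
        (fun k : ℕ => ‖(k : ℝ)⁻¹ • ∑ i ∈ Finset.Icc 1 k, x i‖
          + ‖(k : ℝ)⁻¹ • ∑ i ∈ Finset.Icc 1 k, y i‖) atTop atTop) := by
  have hbot := hR.2.1
  have hτM : 0 < τM := hτm.trans_le hττ
  have hσM : 0 < σM := hσm.trans_le hσσ
  have hc : 0 ≤ σM * ‖A‖ ^ 2 := by positivity
  have hTlow : ∀ u, (L + σM * ‖A‖ ^ 2) * ‖u‖ ^ 2 ≤ ⟪Tinv u, u⟫ := by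
    intro u
    have h := norm_sq_le_mul_inner_rightInverse hτM hTinv' hTsa
      (fun v => le_trans (by positivity) (hTb v).1) (fun v => (hTb v).2) u
    have hq : 0 ≤ ⟪Tinv u, u⟫ := nonneg_of_mul_nonneg_right ((sq_nonneg _).trans h) hτM
    have h1 := mul_le_mul_of_nonneg_left h (add_nonneg hL hc)
    nlinarith
  have hSpos : ∀ v, 0 ≤ ⟪Sg v, v⟫ := fun v => le_trans (by positivity) (hSgb v).1
  have hYoung := neg_half_mul_norm_sq_le (A := A) hσM.le hSgsa hSpos fun v => (hSgb v).2
  have hSginvpos : ∀ v, 0 ≤ ⟪Sginv v, v⟫ := fun v => by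
    have h := hSpos (Sginv v)
    rwa [hSginv', real_inner_comm] at h
  obtain ⟨e, he0, he⟩ : ∃ e : ℕ → Y, e 0 = 0 ∧ ∀ k, e (k + 1) = A (x (k + 1)) - b :=
    ⟨fun k => Nat.casesOn k 0 fun k => A (x (k + 1)) - b, rfl, fun _ => rfl⟩
  have hextrap : ∀ k, (2 : ℝ) • y k - (if k = 0 then ym1 else y (k - 1)) = y k + Sg (e k) := by
    rintro (_ | k)
    · simp [he0, hinit, two_smul]
    · rw [if_neg k.succ_ne_zero, Nat.add_sub_cancel, he, two_smul, add_sub_assoc]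
      congr 1
      rw [hdual k, add_sub_cancel_left]
  simp only [hextrap] at hstep
  have hx : ∀ j, 1 ≤ j → R (x j) ≠ ⊤ := by
    rintro (_ | k) hk
    · omega
    · obtain ⟨u, hu⟩ := hR.1
      exact (toReal_add_inner_le_of_mem_epsSubdiff hbot (hstep k) hu).1
  have hgap : ∀ u v, R u ≠ ⊤ → ∃ C : ℝ, ∀ n : ℕ, ∑ j ∈ Finset.Icc 1 n,
      (((R (x j)).toReal + F (x j) + ⟪v, A (x j) - b⟫)
        - ((R u).toReal + F u + ⟪y j, A u - b⟫)) ≤ C := by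
    intro u v hu
    set E : ℕ → ℝ := fun n => pdEnergy A Tinv Sg Sginv (u - x n) (v - y n) (e n) with hE
    have hsum : ∀ n : ℕ, ∑ j ∈ Finset.Icc 1 n,
        (((R (x j)).toReal + F (x j) + ⟪v, A (x j) - b⟫)
          - ((R u).toReal + F u + ⟪y j, A u - b⟫)) ≤ E 0 - E n + ∑ j ∈ Finset.range (n + 1), ε j := by
      intro n
      induction n with
      | zero => simp [hε 0]
      | succ n ih =>
        rw [Finset.sum_Icc_succ_top (by omega), Finset.sum_range_succ]
        have h := gap_le_pdEnergy_sub hbot hFconv hFgrad hFlip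
          (inner_rightInverse_comm hTinv' hTsa) hSginv (inner_rightInverse_comm hSginv' hSgsa)
          hTlow hYoung (v := v) hu (hstep n) (hdual n)
        rw [← he] at h
        simp only [hE] at ih ⊢
        rw [he] at h ⊢
        linarith
    refine ⟨E 0 + ∑' j, ε j, fun n => (hsum n).trans ?_⟩
    have h1 : 0 ≤ E n := pdEnergy_nonneg (c := σM * ‖A‖ ^ 2)
      (fun w => le_trans (by gcongr; linarith) (hTlow w)) hSginvpos hYoung _ _ _
    have h2 := hεsum.sum_le_tsum (Finset.range (n + 1)) fun j _ => hε j
    linarith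
  have hFcont : Continuous F :=
    continuous_iff_continuousAt.2 fun u => (hFgrad u).continuousAt
  refine ⟨fun xi yi ⟨φ, hφ, hxi, hyi⟩ =>
    isSaddle_of_sum_gap_le hR hFconv hFcont hx hgap hφ.tendsto_atTop hxi hyi, fun hno => ?_⟩
  contrapose! hno
  rw [tendsto_atTop] at hno
  push Not at hno
  obtain ⟨M, hM⟩ := hno
  obtain ⟨U, hle⟩ := @Ultrafilter.exists_le _ _ (frequently_iff_neBot.1 hM)
  obtain ⟨hU, hUM⟩ := le_inf_iff.1 hle
  replace hUM := le_principal_iff.1 hUM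
  obtain ⟨xi, hxi⟩ := U.exists_tendsto_inner (M := M) <| mem_of_superset hUM fun k hk =>
    (le_add_of_nonneg_right (norm_nonneg _)).trans (le_of_lt hk)
  obtain ⟨yi, hyi⟩ := U.exists_tendsto_inner (M := M) <| mem_of_superset hUM fun k hk =>
    (le_add_of_nonneg_left (norm_nonneg _)).trans (le_of_lt hk)
  exact ⟨(xi, yi), isSaddle_of_sum_gap_le hR hFconv hFcont hx hgap
    (tendsto_id.mono_left hU) hxi hyi⟩
end
end

section
/- Suppose there exists x^b ∈ X with A*Ax^b = A*b, and let S := (A*A)^{1/2} be the positive square root of A*A. Let (x_k, y_k) be generated by the scalar exact primal–dual algorithm with data b and initialization y₀ = y₋₁ + σ(Ax₀ − b). Then there exist v₋₁ ∈ X and sequences (u_k), (v_k) in X with u₀ = x₀ and v₀ = v₋₁ + σ(Su₀ − Sx^b), satisfying for every k ≥ 0: ṽ_k = 2v_k − v_{k−1}; u_{k+1} = prox_{τR}(u_k − τ∇F(u_k) − τSṽ_k); v_{k+1} = v_k + σ(Su_{k+1} − Sx^b); and u_k = x_k for every k ≥ 0. In other words, (x_k) is a primal sequence generated by the same procedure applied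 to the normal problem min{R(x) + F(x) : Sx = Sx^b}. -/
open scoped RealInnerProductSpace ENNReal NNReal
open Filter Topology

noncomputable section

variable {X Y : Type*}
  [NormedAddCommGroup X] [InnerProductSpace ℝ X] [CompleteSpace X]
  [NormedAddCommGroup Y] [InnerProductSpace ℝ Y] [CompleteSpace Y]

/-- `p` is the proximal point `prox_{τR}(w)`, i.e. a minimizer of
`u ↦ R u + (1/(2τ))‖u - w‖²`. -/
def IsProx {X : Type*} [NormedAddCommGroup X] [InnerProductSpace ℝ X]
    (R : X → EReal) (τ : ℝ) (w p : X) : Prop :=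
  ∀ u : X, R p + ((1 / (2 * τ) * ‖p - w‖ ^ 2 : ℝ) : EReal)
    ≤ R u + ((1 / (2 * τ) * ‖u - w‖ ^ 2 : ℝ) : EReal)

/-- If `S` is symmetric and `‖A u‖ ≤ ‖S u‖` for all `u`, then the range of the adjoint of `A`
is contained in the range of `S`. -/
theorem exists_apply_eq_adjoint_of_norm_le {X Y : Type*}
    [NormedAddCommGroup X] [InnerProductSpace ℝ X] [CompleteSpace X]
    [NormedAddCommGroup Y] [InnerProductSpace ℝ Y] [CompleteSpace Y]
    (A : X →L[ℝ] Y) (S : X →L[ℝ] X) (hS : ∀ u v : X, ⟪S u, v⟫ = ⟪u, S v⟫)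
    (hAS : ∀ u : X, ‖A u‖ ≤ ‖S u‖) (y : Y) :
    ∃ v : X, S v = ContinuousLinearMap.adjoint A y := by
  let f : Module.Dual ℝ X := ((innerSL ℝ y).comp A).toLinearMap
  have hfS : ∀ u, ‖f u‖ ≤ ‖y‖ * ‖S u‖ := fun u =>
    (norm_inner_le_norm y (A u)).trans (by gcongr; exact hAS u)
  have hf : f ∈ LinearMap.range S.toLinearMap.dualMap := by
    rw [LinearMap.range_dualMap_eq_dualAnnihilator_ker, Submodule.mem_dualAnnihilator]
    intro w hw
    have hw' : S w = 0 := hw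
    simpa [hw'] using hfS w
  obtain ⟨g, hg⟩ := hf
  have hgS : ∀ u, g (S u) = ⟪y, A u⟫ := fun u => LinearMap.congr_fun hg u
  obtain ⟨h, hh, -⟩ := exists_extension_norm_eq (LinearMap.range S.toLinearMap)
    ((g.domRestrict (LinearMap.range S.toLinearMap)).mkContinuous ‖y‖ (by
      rintro ⟨-, u, rfl⟩
      have hu := hfS u
      rw [← hg] at hu
      exact hu))
  refine ⟨(InnerProductSpace.toDual ℝ X).symm h, ext_inner_right ℝ fun u => ?_⟩
  rw [hS, InnerProductSpace.toDual_symm_apply, ContinuousLinearMap.adjoint_inner_left, ← hgS]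
  exact hh ⟨S u, u, rfl⟩

/-- If the normal equation `A*A x = A*b` has a solution `x^b` and
`S = (A*A)^{1/2}`, then the primal sequence of the scalar exact primal–dual algorithm with
data `b` coincides with a primal sequence generated by the same procedure applied to the
normal problem `min {R + F : S x = S x^b}`. -/
theorem statement_8
    (A : X →L[ℝ] Y) (b : Y)
    (R : X → EReal) (hR : ProperConvexLsc R)
    (F : X → ℝ) (F' : X → X) (L : ℝ) (hL : 0 ≤ L)
    (hFconv : ConvexOn ℝ Set.univ F)
    (hFgrad : ∀ u : X, HasGradientAt F (F' u) u)
    (hFlip : ∀ u v : X, ‖F' u - F' v‖ ≤ L * ‖u - v‖)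
    (τ σ : ℝ) (hτ : 0 < τ) (hσ : 0 < σ)
    (xb : X) (hxb : ContinuousLinearMap.adjoint A (A xb) = ContinuousLinearMap.adjoint A b)
    (S : X →L[ℝ] X)
    (hSsa : ∀ u v : X, ⟪S u, v⟫ = ⟪u, S v⟫)
    (hSpos : ∀ u : X, 0 ≤ ⟪S u, u⟫)
    (hSsq : ∀ u : X, S (S u) = ContinuousLinearMap.adjoint A (A u))
    (x : ℕ → X) (y : ℕ → Y) (ym1 : Y)
    (hinit : y 0 = ym1 + σ • (A (x 0) - b))
    (hstep : ∀ k : ℕ,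
      IsProx R τ
        (x k - τ • F' (x k)
          - τ • ContinuousLinearMap.adjoint A
              ((2 : ℝ) • y k - (if k = 0 then ym1 else y (k - 1))))
        (x (k + 1)))
    (hdual : ∀ k : ℕ, y (k + 1) = y k + σ • (A (x (k + 1)) - b)) :
    ∃ vm1 : X, ∃ u v : ℕ → X,
      u 0 = x 0 ∧
      v 0 = vm1 + σ • (S (u 0) - S xb) ∧
      (∀ k : ℕ,
        IsProx R τ
          (u k - τ • F' (u k)
            - τ • S ((2 : ℝ) • v k - (if k = 0 then vm1 else v (k - 1))))
          (u (k + 1))) ∧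
      (∀ k : ℕ, v (k + 1) = v k + σ • (S (u (k + 1)) - S xb)) ∧
      ∀ k : ℕ, u k = x k := by
  have hnorm : ∀ u : X, ‖A u‖ ≤ ‖S u‖ := fun u => by
    rw [← sq_le_sq₀ (norm_nonneg _) (norm_nonneg _), ← real_inner_self_eq_norm_sq,
      ← real_inner_self_eq_norm_sq, hSsa, hSsq, ContinuousLinearMap.adjoint_inner_right]
  obtain ⟨vm1, hvm1⟩ := exists_apply_eq_adjoint_of_norm_le A S hSsa hnorm ym1
  let v : ℕ → X := fun k => Nat.rec (vm1 + σ • (S (x 0) - S xb))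
    (fun n w => w + σ • (S (x (n + 1)) - S xb)) k
  have hv0 : v 0 = vm1 + σ • (S (x 0) - S xb) := rfl
  have hvs : ∀ k, v (k + 1) = v k + σ • (S (x (k + 1)) - S xb) := fun _ => rfl
  have hSv : ∀ k, S (v k) = ContinuousLinearMap.adjoint A (y k) := by
    intro k
    induction k with
    | zero => simp only [hv0, hinit, map_add, map_smul, map_sub, hSsq, hvm1, hxb]
    | succ k ih => simp only [hvs, hdual, map_add, map_smul, map_sub, hSsq, ih, hxb]
  refine ⟨vm1, x, v, rfl, hv0, fun k => ?_, hvs, fun _ => rfl⟩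
  convert hstep k using 3
  rw [map_sub, map_sub, map_smul, map_smul, hSv]
  split_ifs <;> simp only [hvm1, hSv]
end
end
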